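/- Let u : ℝⁿ → ℝ be η-strongly convex for some η > 0, let η̃ ∈ (0, η), and let (ε_k)_{k∈ℕ} be a sequence of positive numbers with ε_k → 0. Then there exists a sequence (v_k)_{k∈ℕ} of η̃-strongly convex functions in C²(ℝⁿ) such that: (a) the Lebesgue measure of {x ∈ ℝⁿ : v_k(x) ≠ u(x)} is less than ε_k for every k ∈ ℕ; (b) v_k converges to u uniformly on every compact subset of ℝⁿ. -/

import Mathlib

open MeasureTheory Metric Set Filter
open scoped ENNReal

/-- `u : ℝⁿ → ℝ` is `η`-strongly convex: `x ↦ u x - (η/2)‖x‖²` is convex. -/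
def StronglyConvexWith {n : ℕ} (η : ℝ) (u : EuclideanSpace ℝ (Fin n) → ℝ) : Prop :=
  ConvexOn ℝ Set.univ (fun x => u x - η / 2 * ‖x‖ ^ 2)

section Alexandrov

open scoped RealInnerProductSpace Topology NNReal

/-- `p` is a subgradient of `u` at `x`, with the quadratic gain of `η`-strong convexity. -/
def IsStrongSubgradient {E : Type*} [NormedAddCommGroup E] [InnerProductSpace ℝ E]
    (η : ℝ) (u : E → ℝ) (x p : E) : Prop :=
  ∀ z, u x + ⟪p, z - x⟫ + η / 2 * ‖z - x‖ ^ 2 ≤ u z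

/-- The remainder of `u` at `x + h` relative to the second order polynomial with gradient `p` and
Hessian `A` at `x`. -/
noncomputable def taylorRemainder {E : Type*} [NormedAddCommGroup E] [InnerProductSpace ℝ E]
    (u : E → ℝ) (x p : E) (A : E →L[ℝ] E) (h : E) : ℝ :=
  u (x + h) - u x - ⟪p, h⟫ - 1 / 2 * ⟪A h, h⟫

variable {E : Type*} [NormedAddCommGroup E] [InnerProductSpace ℝ E]

lemma ConvexOn.exists_subgradient [FiniteDimensional ℝ E] {f : E → ℝ}
    (hf : ConvexOn ℝ univ f) (x : E) : ∃ p : E, ∀ z, f x + ⟪p, z - x⟫ ≤ f z := by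
  have hcont : Continuous f := hf.locallyLipschitz.continuous
  have hopen : IsOpen {q : E × ℝ | f q.1 < q.2} :=
    isOpen_lt (hcont.comp continuous_fst) continuous_snd
  have hconv : Convex ℝ {q : E × ℝ | f q.1 < q.2} := by
    have := hf.convex_strict_epigraph
    simpa using this
  obtain ⟨g, hg⟩ := geometric_hahn_banach_open_point (x := (x, f x)) hconv hopen
    (by simp)
  have hdecomp : ∀ (z : E) (t : ℝ), g (z, t) = g (z, 0) + t * g (0, 1) := by
    intro z t
    have : ((z, t) : E × ℝ) = (z, 0) + t • ((0 : E), (1 : ℝ)) := by simp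
    rw [this, map_add, map_smul, smul_eq_mul]
  have hs : g (0, 1) < 0 := by
    have := hg (x, f x + 1) (by simp)
    rw [hdecomp x (f x + 1), hdecomp x (f x)] at this
    linarith
  let φ : E →L[ℝ] ℝ := (-(g (0, 1))⁻¹) • (g.comp (ContinuousLinearMap.inl ℝ E ℝ))
  refine ⟨(InnerProductSpace.toDual ℝ E).symm φ, fun z => ?_⟩
  rw [InnerProductSpace.toDual_symm_apply]
  have key : g (z, 0) + f z * g (0, 1) ≤ g (x, 0) + f x * g (0, 1) := by
    refine le_of_forall_pos_lt_add fun e he => ?_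
    have := hg (z, f z + e / (-(g (0, 1)))) (by
      simpa using div_pos he (neg_pos.2 hs))
    rw [hdecomp z, hdecomp x] at this
    have h2 : e / (-(g (0, 1))) * g (0, 1) = -e := by
      field_simp [hs.ne]
    nlinarith
  have hφ : φ (z - x) = -(g (0, 1))⁻¹ * (g (z, 0) - g (x, 0)) := by
    simp only [φ, FunLike.coe_smul, Pi.smul_apply, ContinuousLinearMap.comp_apply,
      ContinuousLinearMap.inl_apply, smul_eq_mul]
    rw [← map_sub]; simp
  rw [hφ]
  have h3 : (f x - f z) * (-g (0, 1)) ≤ g (x, 0) - g (z, 0) := by linarith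
  have h4 := (le_div_iff₀ (neg_pos.2 hs)).2 h3
  have h5 : -(g (0, 1))⁻¹ * (g (z, 0) - g (x, 0)) = -((g (x, 0) - g (z, 0)) / (-g (0, 1))) := by
    field_simp [hs.ne]; ring
  rw [h5]; linarith

lemma exists_isStrongSubgradient [FiniteDimensional ℝ E] {η : ℝ} {u : E → ℝ}
    (hu : ConvexOn ℝ univ fun x => u x - η / 2 * ‖x‖ ^ 2) (x : E) :
    ∃ p, IsStrongSubgradient η u x p := by
  obtain ⟨q, hq⟩ := hu.exists_subgradient x
  refine ⟨q + η • x, fun z => ?_⟩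
  have h1 := hq z
  have h2 : ‖z‖ ^ 2 = ‖x‖ ^ 2 + 2 * ⟪x, z - x⟫ + ‖z - x‖ ^ 2 := by
    rw [← norm_add_sq_real]; simp
  rw [inner_add_left, real_inner_smul_left]
  rw [h2] at h1
  linarith

lemma IsStrongSubgradient.inner_sub_ge {η : ℝ} {u : E → ℝ} {x y p q : E}
    (hp : IsStrongSubgradient η u x p) (hq : IsStrongSubgradient η u y q) :
    η * ‖x - y‖ ^ 2 ≤ ⟪p - q, x - y⟫ := by
  have h1 := hp y
  have h2 := hq x
  rw [norm_sub_rev] at h1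
  have h3 : ⟪p, y - x⟫ = -⟪p, x - y⟫ := by rw [← inner_neg_right, neg_sub]
  rw [inner_sub_left]
  linarith

lemma IsStrongSubgradient.norm_sub_le {η : ℝ} (hη : 0 < η) {u : E → ℝ} {x y p q : E}
    (hp : IsStrongSubgradient η u x p) (hq : IsStrongSubgradient η u y q) :
    ‖x - y‖ ≤ η⁻¹ * ‖p - q‖ := by
  have h1 := hp.inner_sub_ge hq
  have h2 := real_inner_le_norm (p - q) (x - y)
  rcases (norm_nonneg (x - y)).eq_or_lt with h | h
  · rw [← h]; positivity
  · rw [inv_mul_eq_div, le_div_iff₀ hη]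
    nlinarith

/-- The inverse of the subdifferential of a strongly convex function is Lipschitz. -/
lemma exists_lipschitz_inverse_subgradient [FiniteDimensional ℝ E] {η : ℝ} (hη : 0 < η)
    (u : E → ℝ) : ∃ (C : ℝ≥0) (G : E → E), LipschitzWith C G ∧
      ∀ x p, IsStrongSubgradient η u x p → G p = x := by
  classical
  let S : Set E := {p | ∃ x, IsStrongSubgradient η u x p}
  let G₀ : E → E := fun p => if h : p ∈ S then h.choose else 0
  have hG₀ : ∀ p ∈ S, IsStrongSubgradient η u (G₀ p) p := by
    intro p hp
    simp only [G₀, dif_pos hp]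
    exact hp.choose_spec
  have hlip : LipschitzOnWith (Real.toNNReal η⁻¹) G₀ S := by
    refine LipschitzOnWith.of_dist_le_mul fun p hp q hq => ?_
    rw [dist_eq_norm, dist_eq_norm, Real.coe_toNNReal _ (inv_pos.2 hη).le]
    exact (hG₀ p hp).norm_sub_le hη (hG₀ q hq)
  obtain ⟨G, hG, hGeq⟩ := hlip.extend_finite_dimension
  refine ⟨_, G, hG, fun x p hp => ?_⟩
  have hpS : p ∈ S := ⟨x, hp⟩
  rw [← hGeq hpS]
  have := (hG₀ p hpS).norm_sub_le hη hp
  simpa [sub_eq_zero] using this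

lemma LocallyLipschitz.ae_differentiableAt [FiniteDimensional ℝ E] [MeasurableSpace E]
    [BorelSpace E] {f : E → ℝ} (hf : LocallyLipschitz f) :
    ∀ᵐ x, DifferentiableAt ℝ f x := by
  have h1 : ∀ x : E, ∃ K : ℝ≥0, ∃ t : Set E, t ∈ 𝓝 x ∧ IsOpen t ∧ LipschitzOnWith K f t := by
    intro x
    obtain ⟨K, t, ht, hK⟩ := hf x
    obtain ⟨s, hst, hs, hxs⟩ := _root_.mem_nhds_iff.1 ht
    exact ⟨K, s, hs.mem_nhds hxs, hs, hK.mono hst⟩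
  choose K t htx hto hK using h1
  obtain ⟨s, hsc, hs⟩ := TopologicalSpace.countable_cover_nhds htx
  have h2 : ∀ x ∈ s, ∀ᵐ y, y ∈ t x → DifferentiableAt ℝ f y := by
    intro x _
    filter_upwards [(hK x).ae_differentiableWithinAt_of_mem (μ := volume)] with y hy hyt
    exact (hy hyt).differentiableAt ((hto x).mem_nhds hyt)
  filter_upwards [(ae_ball_iff hsc).2 h2] with y hy
  have : y ∈ ⋃ x ∈ s, t x := hs ▸ mem_univ y
  obtain ⟨x, hx, hyx⟩ := mem_iUnion₂.1 this
  exact hy x hx hyx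

lemma LipschitzWith.addHaar_image_eq_zero [FiniteDimensional ℝ E] [MeasurableSpace E]
    [BorelSpace E] {C : ℝ≥0} {G : E → E} (hG : LipschitzWith C G) {N : Set E}
    (hN : volume N = 0) : volume (G '' N) = 0 := by
  have h : ∀ s : Set E, volume s = 0 ↔ μH[Module.finrank ℝ E] s = 0 := by
    intro s
    have h1 := Measure.absolutelyContinuous_isAddHaarMeasure (volume : Measure E)
      μH[Module.finrank ℝ E]
    have h2 := Measure.absolutelyContinuous_isAddHaarMeasure μH[Module.finrank ℝ E]
      (volume : Measure E)
    exact ⟨fun h => h2 h, fun h => h1 h⟩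
  rw [h] at hN ⊢
  have := hG.hausdorffMeasure_image_le (d := Module.finrank ℝ E) (by positivity) N
  rw [hN, mul_zero] at this
  exact le_antisymm this bot_le

/-- The gradient of a strongly convex function at a point of differentiability, compared with the
subgradients at nearby points. -/
lemma tendsto_subgradient {η : ℝ} (hη : 0 ≤ η) {u : E → ℝ} {p : E → E}
    (hp : ∀ x, IsStrongSubgradient η u x (p x)) {x : E} (hd : DifferentiableAt ℝ u x) :
    Tendsto p (𝓝 x) (𝓝 (p x)) := by
  have hsub : ∀ y z, u y + ⟪p y, z - y⟫ ≤ u z := fun y z => by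
    have := hp y z
    nlinarith [sq_nonneg ‖z - y‖, mul_nonneg hη (sq_nonneg ‖z - y‖)]
  have key : ∀ ε > 0, ∀ᶠ h in 𝓝 (0 : E), ∀ e : E, ‖e‖ = 1 →
      h ≠ 0 → ⟪p (x + h), e⟫ - fderiv ℝ u x e ≤ 3 * ε := by
    intro ε hε
    have h1 := hd.hasFDerivAt.isLittleO
    rw [Asymptotics.isLittleO_iff] at h1
    obtain ⟨r, hr, hb⟩ := Metric.eventually_nhds_iff.1 (h1 hε)
    have hb' : ∀ k : E, ‖k‖ < r → |u (x + k) - u x - fderiv ℝ u x k| ≤ ε * ‖k‖ := by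
      intro k hk
      have := @hb (x + k) (by simpa using hk)
      simpa using this
    filter_upwards [Metric.ball_mem_nhds (0 : E) (half_pos hr)] with h hh e he hne
    have hhn : ‖h‖ < r / 2 := by simpa using hh
    have hpos : 0 < ‖h‖ := norm_pos_iff.2 hne
    have hte : ‖‖h‖ • e‖ = ‖h‖ := by rw [norm_smul, he]; simp
    have hsum : ‖h + ‖h‖ • e‖ ≤ 2 * ‖h‖ := by
      calc _ ≤ ‖h‖ + ‖‖h‖ • e‖ := norm_add_le _ _
        _ = _ := by rw [hte]; ring
    have a1 := abs_le.1 (hb' (h + ‖h‖ • e) (by linarith))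
    have a2 := abs_le.1 (hb' h (by linarith))
    have a3 := hsub (x + h) (x + (h + ‖h‖ • e))
    have a4 : x + (h + ‖h‖ • e) - (x + h) = ‖h‖ • e := by abel
    rw [a4, real_inner_smul_right] at a3
    rw [map_add, map_smul, smul_eq_mul] at a1
    have a5 : ‖h‖ * (⟪p (x + h), e⟫ - fderiv ℝ u x e) ≤ ‖h‖ * (3 * ε) := by
      nlinarith
    exact le_of_mul_le_mul_left a5 hpos
  have hpx : ∀ h, fderiv ℝ u x h = ⟪p x, h⟫ := by
    have h0 : IsLocalMin (fun z => u z - ⟪p x, z - x⟫) x := by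
      filter_upwards with z
      have := hsub x z
      simp; linarith
    have h1 : HasFDerivAt (fun z => u z - ⟪p x, z - x⟫) (fderiv ℝ u x - innerSL ℝ (p x)) x := by
      refine hd.hasFDerivAt.sub ?_
      have : HasFDerivAt (fun z => innerSL ℝ (p x) (z - x)) (innerSL ℝ (p x)) x :=
        (innerSL ℝ (p x)).hasFDerivAt.comp x ((hasFDerivAt_id x).sub_const x)
      simpa using this
    have h2 := h0.hasFDerivAt_eq_zero h1
    intro h
    have h3 := congrArg (fun T => T h) (sub_eq_zero.1 h2)
    simpa using h3
  rw [Metric.tendsto_nhds]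
  intro ε hε
  have hmap := key (ε / 4) (by positivity)
  have : Tendsto (fun y => y - x) (𝓝 x) (𝓝 0) := by
    have : Continuous fun y : E => y - x := by fun_prop
    simpa using this.tendsto x
  filter_upwards [this.eventually hmap] with y hy
  rw [dist_eq_norm]
  by_cases hyx : y = x
  · simp [hyx, hε]
  by_cases hpp : p y - p x = 0
  · simpa [hpp] using hε
  have hn : 0 < ‖p y - p x‖ := norm_pos_iff.2 hpp
  have h1 := hy (‖p y - p x‖⁻¹ • (p y - p x)) (by
    rw [norm_smul, norm_inv, norm_norm, inv_mul_cancel₀ hn.ne']) (sub_ne_zero.2 hyx)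
  rw [hpx, ← inner_sub_left, add_sub_cancel, real_inner_smul_right, real_inner_self_eq_norm_sq] at h1
  have h2 : ‖p y - p x‖⁻¹ * ‖p y - p x‖ ^ 2 = ‖p y - p x‖ := by field_simp
  linarith

/-- A first order expansion of the subgradients at `x` gives a second order expansion of the
function at `x`. -/
lemma abs_taylorRemainder_le_of_subgradient {η : ℝ} (hη : 0 ≤ η) {u : E → ℝ} {p : E → E}
    (hp : ∀ x, IsStrongSubgradient η u x (p x)) {x h : E} {A : E →L[ℝ] E} {ω : ℝ}
    (hb : ∀ t ∈ Icc (0 : ℝ) 1, ‖p (x + t • h) - p x - A (t • h)‖ ≤ ω * ‖h‖) :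
    |taylorRemainder u x (p x) A h| ≤ ω * ‖h‖ ^ 2 := by
  have hsub : ∀ y z, u y + ⟪p y, z - y⟫ ≤ u z := fun y z => by
    have := hp y z
    nlinarith [sq_nonneg ‖z - y‖, mul_nonneg hη (sq_nonneg ‖z - y‖)]
  set a : ℝ := ⟪A h, h⟫ with ha
  let e : ℝ → ℝ := fun t => u (x + t • h) - t * ⟪p x, h⟫ - t ^ 2 / 2 * a
  have hin : ∀ t ∈ Icc (0 : ℝ) 1, |⟪p (x + t • h), h⟫ - ⟪p x, h⟫ - t * a| ≤ ω * ‖h‖ ^ 2 := by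
    intro t ht
    have h1 : ⟪p (x + t • h), h⟫ - ⟪p x, h⟫ - t * a = ⟪p (x + t • h) - p x - A (t • h), h⟫ := by
      rw [inner_sub_left, inner_sub_left, map_smul, real_inner_smul_left]
    rw [h1]
    calc _ ≤ ‖p (x + t • h) - p x - A (t • h)‖ * ‖h‖ := abs_real_inner_le_norm _ _
      _ ≤ ω * ‖h‖ * ‖h‖ := by gcongr; exact hb t ht
      _ = _ := by ring
  have hstep : ∀ s ∈ Icc (0 : ℝ) 1, ∀ t ∈ Icc (0 : ℝ) 1, s ≤ t →
      |e t - e s| ≤ (t - s) * (ω * ‖h‖ ^ 2 + (t - s) * |a| / 2) := by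
    intro s hs t ht hst
    have b1 := hsub (x + s • h) (x + t • h)
    have b2 := hsub (x + t • h) (x + s • h)
    have c1 : x + t • h - (x + s • h) = (t - s) • h := by rw [sub_smul]; abel
    have c2 : x + s • h - (x + t • h) = (s - t) • h := by rw [sub_smul]; abel
    rw [c1, real_inner_smul_right] at b1
    rw [c2, real_inner_smul_right] at b2
    have d1 := abs_le.1 (hin s hs)
    have d2 := abs_le.1 (hin t ht)
    have hts : 0 ≤ t - s := sub_nonneg.2 hst
    have e1 := mul_le_mul_of_nonneg_left d1.1 hts
    have e2 := mul_le_mul_of_nonneg_left d2.2 hts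
    have f1 := mul_le_mul_of_nonneg_left (le_abs_self a) (sq_nonneg (t - s))
    have f2 := mul_le_mul_of_nonneg_left (neg_abs_le a) (sq_nonneg (t - s))
    simp only [e]
    rw [abs_le]
    constructor <;> nlinarith
  have hpart : ∀ m : ℕ, |e 1 - e 0| ≤ ω * ‖h‖ ^ 2 + |a| / 2 * (1 / ((m : ℝ) + 1)) := by
    intro m
    have hm : (0 : ℝ) < m + 1 := by positivity
    have h1 : e 1 - e 0 = ∑ i ∈ Finset.range (m + 1),
        (e (((i + 1 : ℕ) : ℝ) / (m + 1)) - e ((i : ℝ) / (m + 1))) := by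
      rw [Finset.sum_range_sub (fun i : ℕ => e ((i : ℝ) / (m + 1)))]
      simp [div_self hm.ne']
    rw [h1]
    have hle : ∀ i ∈ Finset.range (m + 1),
        |e (((i + 1 : ℕ) : ℝ) / (m + 1)) - e ((i : ℝ) / (m + 1))| ≤
          1 / ((m : ℝ) + 1) * (ω * ‖h‖ ^ 2 + 1 / ((m : ℝ) + 1) * |a| / 2) := by
      intro i hi
      have hi' : i + 1 ≤ m + 1 := Finset.mem_range.1 hi
      have hi'' : ((i + 1 : ℕ) : ℝ) ≤ m + 1 := by exact_mod_cast hi'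
      have := hstep (i / (m + 1)) ⟨by positivity, by
        rw [div_le_one hm]; push_cast at hi''; linarith⟩ ((i + 1 : ℕ) / (m + 1))
        ⟨by positivity, by rw [div_le_one hm]; exact hi''⟩ (by gcongr; simp)
      have hd : ((i + 1 : ℕ) : ℝ) / (m + 1) - i / (m + 1) = 1 / ((m : ℝ) + 1) := by
        push_cast; field_simp; ring
      rwa [hd] at this
    calc _ ≤ ∑ i ∈ Finset.range (m + 1),
        |e (((i + 1 : ℕ) : ℝ) / (m + 1)) - e ((i : ℝ) / (m + 1))| :=
          Finset.abs_sum_le_sum_abs _ _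
      _ ≤ ∑ i ∈ Finset.range (m + 1),
          1 / ((m : ℝ) + 1) * (ω * ‖h‖ ^ 2 + 1 / ((m : ℝ) + 1) * |a| / 2) :=
          Finset.sum_le_sum hle
      _ = _ := by
        rw [Finset.sum_const, Finset.card_range, nsmul_eq_mul]; push_cast
        field_simp
  have hlim : Tendsto (fun m : ℕ => ω * ‖h‖ ^ 2 + |a| / 2 * (1 / ((m : ℝ) + 1))) atTop
      (𝓝 (ω * ‖h‖ ^ 2 + |a| / 2 * 0)) :=
    (tendsto_one_div_add_atTop_nhds_zero_nat.const_mul _).const_add _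
  have := ge_of_tendsto' hlim hpart
  have he : e 1 - e 0 = taylorRemainder u x (p x) A h := by
    simp only [e, taylorRemainder, one_smul, zero_smul, add_zero]; ring
  rw [he] at this
  simpa using this

/-- **Alexandrov's theorem** for strongly convex functions. -/
theorem ae_exists_taylorRemainder_le [FiniteDimensional ℝ E] [MeasurableSpace E] [BorelSpace E]
    {η : ℝ} (hη : 0 < η) {u : E → ℝ} (hu : ConvexOn ℝ univ fun x => u x - η / 2 * ‖x‖ ^ 2)
    (hlip : LocallyLipschitz u) :
    ∀ᵐ x, ∃ (p : E) (A : E →L[ℝ] E), ∀ ω > 0, ∃ δ > 0, ∀ h : E, ‖h‖ ≤ δ →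
      |taylorRemainder u x p A h| ≤ ω * ‖h‖ ^ 2 := by
  choose p hp using exists_isStrongSubgradient hu
  obtain ⟨C, G, hG, hGp⟩ := exists_lipschitz_inverse_subgradient hη u
  have hGp' : ∀ x, G (p x) = x := fun x => hGp x _ (hp x)
  have hN : volume (G '' {y | ¬ DifferentiableAt ℝ G y}) = 0 :=
    hG.addHaar_image_eq_zero (by simpa [ae_iff] using hG.ae_differentiableAt (μ := volume))
  have hZ : volume (G '' {y | DifferentiableAt ℝ G y ∧ (fderiv ℝ G y).det = 0}) = 0 :=
    addHaar_image_eq_zero_of_det_fderivWithin_eq_zero volume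
      (fun y hy => hy.1.hasFDerivAt.hasFDerivWithinAt) (fun y hy => hy.2)
  filter_upwards [compl_mem_ae_iff.2 hN, compl_mem_ae_iff.2 hZ, hlip.ae_differentiableAt]
    with x hxN hxZ hxd
  have hd : DifferentiableAt ℝ G (p x) := by
    by_contra hcon
    exact hxN ⟨p x, hcon, hGp' x⟩
  have hdet : (fderiv ℝ G (p x)).det ≠ 0 := fun hcon => hxZ ⟨p x, ⟨hd, hcon⟩, hGp' x⟩
  let B := (fderiv ℝ G (p x)).toContinuousLinearEquivOfDetNeZero hdet
  have hB : ∀ v, B v = fderiv ℝ G (p x) v := fun v => rfl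
  let A : E →L[ℝ] E := B.symm
  have hAB : ∀ v, A (fderiv ℝ G (p x) v) = v := fun v => by
    rw [← hB]; exact B.symm_apply_apply v
  have hcont := tendsto_subgradient hη.le hp hxd
  refine ⟨p x, A, fun ω hω => ?_⟩
  have h1 := hd.hasFDerivAt.isLittleO
  rw [Asymptotics.isLittleO_iff] at h1
  have hA : 0 < ‖A‖ + 1 := by positivity
  set κ : ℝ := min (1 / (2 * (‖A‖ + 1))) (ω / (2 * (‖A‖ + 1) ^ 2)) with hκ
  have hκ0 : 0 < κ := by positivity
  have hκ1 : κ * (‖A‖ + 1) ≤ 1 / 2 := by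
    calc _ ≤ 1 / (2 * (‖A‖ + 1)) * (‖A‖ + 1) := by gcongr; exact min_le_left _ _
      _ = _ := by field_simp
  have hκ2 : κ * (2 * (‖A‖ + 1) ^ 2) ≤ ω := by
    calc _ ≤ ω / (2 * (‖A‖ + 1) ^ 2) * (2 * (‖A‖ + 1) ^ 2) := by gcongr; exact min_le_right _ _
      _ = _ := by field_simp
  have h2 := hcont.eventually (h1 hκ0)
  obtain ⟨r, hr, hb⟩ := Metric.eventually_nhds_iff.1 h2
  have hgrad : ∀ k : E, ‖k‖ < r → ‖p (x + k) - p x - A k‖ ≤ ω * ‖k‖ := by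
    intro k hk
    have h3 := @hb (x + k) (by simpa using hk)
    rw [hGp', hGp', add_sub_cancel_left] at h3
    set q := p (x + k) - p x with hq
    have h4 : q - A k = -A (k - fderiv ℝ G (p x) q) := by
      rw [map_sub, hAB]; abel
    have h5 : ‖q - A k‖ ≤ ‖A‖ * (κ * ‖q‖) := by
      rw [h4, norm_neg]
      exact (A.le_opNorm _).trans (by gcongr)
    have h6 : ‖q‖ ≤ ‖q - A k‖ + ‖A k‖ := by
      simpa using norm_add_le (q - A k) (A k)
    have h7 := A.le_opNorm k
    have h8 : ‖q‖ ≤ 2 * (‖A‖ + 1) * ‖k‖ := by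
      nlinarith [norm_nonneg q, norm_nonneg k]
    calc _ ≤ ‖A‖ * (κ * ‖q‖) := h5
      _ ≤ (‖A‖ + 1) * (κ * (2 * (‖A‖ + 1) * ‖k‖)) := by gcongr; linarith
      _ = κ * (2 * (‖A‖ + 1) ^ 2) * ‖k‖ := by ring
      _ ≤ ω * ‖k‖ := by gcongr
  refine ⟨r / 2, half_pos hr, fun h hh => ?_⟩
  refine abs_taylorRemainder_le_of_subgradient hη.le hp fun t ht => ?_
  have hth : ‖t • h‖ ≤ ‖h‖ := by
    rw [norm_smul, Real.norm_of_nonneg ht.1]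
    exact mul_le_of_le_one_left (norm_nonneg _) ht.2
  exact (hgrad (t • h) (by linarith)).trans (by gcongr)

end Alexandrov

section UniformTaylor

open scoped RealInnerProductSpace Topology NNReal

variable {E : Type*} [NormedAddCommGroup E] [InnerProductSpace ℝ E]

lemma taylorRemainder_eq_add (u : E → ℝ) (x p q : E) (A B : E →L[ℝ] E) (h : E) :
    taylorRemainder u x p A h =
      taylorRemainder u x q B h + (⟪q - p, h⟫ + 1 / 2 * ⟪(B - A) h, h⟫) := by
  simp only [taylorRemainder, inner_sub_left, _root_.sub_apply]
  ring

lemma eq_zero_and_abs_le_of_eventually {a b c : ℝ}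
    (h : ∀ ω > 0, ∀ᶠ t in 𝓝[>] (0 : ℝ), |t * a + t ^ 2 * b| ≤ t ^ 2 * (c + ω)) :
    a = 0 ∧ |b| ≤ c := by
  have ha : |a| ≤ 0 := by
    have hlim : Tendsto (fun t : ℝ => t * (c + 1 + |b|)) (𝓝[>] 0) (𝓝 (0 * (c + 1 + |b|))) :=
      (tendsto_id.mono_left nhdsWithin_le_nhds).mul_const _
    rw [zero_mul] at hlim
    refine ge_of_tendsto hlim ?_
    filter_upwards [h 1 one_pos, self_mem_nhdsWithin] with t ht htpos
    have htpos' : 0 < t := htpos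
    have h1 : |t * a| ≤ |t * a + t ^ 2 * b| + |t ^ 2 * b| := by
      have := abs_sub (t * a + t ^ 2 * b) (t ^ 2 * b)
      rwa [add_sub_cancel_right] at this
    rw [abs_mul, abs_mul, abs_of_pos htpos', abs_of_pos (by positivity : 0 < t ^ 2)] at h1
    refine le_of_mul_le_mul_left ?_ htpos'
    nlinarith
  have ha0 : a = 0 := abs_nonpos_iff.1 ha
  refine ⟨ha0, le_of_forall_pos_le_add fun ω hω => ?_⟩
  obtain ⟨t, ht, htpos⟩ := ((h ω hω).and self_mem_nhdsWithin).exists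
  have htpos' : 0 < t := htpos
  rw [ha0, mul_zero, zero_add, abs_mul, abs_of_pos (by positivity : 0 < t ^ 2)] at ht
  exact le_of_mul_le_mul_left ht (by positivity)

/-- Two second order polynomials approximating the same function at the same point are close. -/
lemma inner_sub_eq_zero_and_abs_le {u : E → ℝ} {x p q : E} {A B : E →L[ℝ] E} {c r : ℝ} (hr : 0 < r)
    (hA : ∀ ω > 0, ∃ δ > 0, ∀ h : E, ‖h‖ ≤ δ → |taylorRemainder u x p A h| ≤ ω * ‖h‖ ^ 2)
    (hB : ∀ h : E, ‖h‖ ≤ r → |taylorRemainder u x q B h| ≤ c * ‖h‖ ^ 2) (h : E) :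
    ⟪q - p, h⟫ = 0 ∧ |1 / 2 * ⟪(B - A) h, h⟫| ≤ c * ‖h‖ ^ 2 := by
  refine eq_zero_and_abs_le_of_eventually fun ω hω => ?_
  have hω' : 0 < ω / (‖h‖ ^ 2 + 1) := by positivity
  obtain ⟨δ, hδ, hδA⟩ := hA _ hω'
  have hcont : Tendsto (fun t : ℝ => ‖t • h‖) (𝓝[>] 0) (𝓝 0) := by
    have : Continuous fun t : ℝ => ‖t • h‖ := by fun_prop
    simpa using (this.tendsto 0).mono_left nhdsWithin_le_nhds
  filter_upwards [hcont.eventually_le_const hδ, hcont.eventually_le_const hr] with t h1 h2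
  have e1 := hδA _ h1
  have e2 := hB _ h2
  have e3 := taylorRemainder_eq_add u x p q A B (t • h)
  rw [norm_smul, mul_pow, Real.norm_eq_abs, sq_abs] at e1 e2
  have e4 : t * ⟪q - p, h⟫ + t ^ 2 * (1 / 2 * ⟪(B - A) h, h⟫) =
      taylorRemainder u x p A (t • h) - taylorRemainder u x q B (t • h) := by
    rw [e3, map_smul, real_inner_smul_right, real_inner_smul_right, real_inner_smul_left]; ring
  rw [e4]
  have e5 : ω / (‖h‖ ^ 2 + 1) * (t ^ 2 * ‖h‖ ^ 2) ≤ t ^ 2 * ω := by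
    rw [div_mul_eq_mul_div, div_le_iff₀ (by positivity)]
    nlinarith [mul_nonneg (sq_nonneg t) hω.le]
  calc _ ≤ |taylorRemainder u x p A (t • h)| + |taylorRemainder u x q B (t • h)| := abs_sub _ _
    _ ≤ t ^ 2 * ω + c * (t ^ 2 * ‖h‖ ^ 2) := by gcongr; exact e1.trans e5
    _ = _ := by ring

/-- The points at which `u` has a second order expansion with coefficients bounded by `N` and with
relative error at most `c` at scale `1 / (N + 1)`. -/
def taylorSet (u : E → ℝ) (c : ℝ) (N : ℕ) : Set E :=
  {x | ∃ (p : E) (A : E →L[ℝ] E), ‖p‖ ≤ N ∧ ‖A‖ ≤ N ∧ ∀ h : E, ‖h‖ ≤ 1 / ((N : ℝ) + 1) →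
    |taylorRemainder u x p A h| ≤ c * ‖h‖ ^ 2}

lemma taylorSet_mono (u : E → ℝ) (c : ℝ) : Monotone (taylorSet u c) := by
  rintro N N' hN x ⟨p, A, hp, hA, h⟩
  have hN' : (N : ℝ) ≤ N' := by exact_mod_cast hN
  exact ⟨p, A, hp.trans hN', hA.trans hN', fun v hv => h v (hv.trans (by gcongr))⟩

lemma isClosed_taylorSet [FiniteDimensional ℝ E] {u : E → ℝ} (hu : Continuous u) (c : ℝ) (N : ℕ) :
    IsClosed (taylorSet u c N) := by
  have : ProperSpace (E × (E →L[ℝ] E)) := FiniteDimensional.proper ℝ _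
  have : CompactSpace (closedBall (0 : E × (E →L[ℝ] E)) N) :=
    isCompact_iff_compactSpace.1 (isCompact_closedBall _ _)
  let F : Set (E × closedBall (0 : E × (E →L[ℝ] E)) N) :=
    {q | ∀ h : E, ‖h‖ ≤ 1 / ((N : ℝ) + 1) →
      |taylorRemainder u q.1 q.2.1.1 q.2.1.2 h| ≤ c * ‖h‖ ^ 2}
  have hF : IsClosed F := by
    simp only [F, ofPred_forall]
    refine isClosed_iInter fun h => isClosed_iInter fun _ => isClosed_le ?_ continuous_const
    simp only [taylorRemainder]
    fun_prop
  have himg : taylorSet u c N = Prod.fst '' F := by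
    ext x
    constructor
    · rintro ⟨p, A, hp, hA, h⟩
      exact ⟨(x, ⟨(p, A), by simp [Prod.norm_def, hp, hA]⟩), h, rfl⟩
    · rintro ⟨⟨y, ⟨⟨p, A⟩, hpA⟩⟩, h, rfl⟩
      have : ‖p‖ ≤ N ∧ ‖A‖ ≤ N := by simpa [Prod.norm_def] using hpA
      exact ⟨p, A, this.1, this.2, h⟩
  rw [himg]
  exact isClosedMap_fst_of_compactSpace _ hF

/-- Second order expansions are uniform off a set of small measure. -/
lemma exists_uniform_taylor [FiniteDimensional ℝ E] [MeasurableSpace E] [BorelSpace E]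
    {u : E → ℝ} (hu : Continuous u)
    (hT : ∀ᵐ x, ∃ (p : E) (A : E →L[ℝ] E), ∀ ω > 0, ∃ δ > 0, ∀ h : E, ‖h‖ ≤ δ →
      |taylorRemainder u x p A h| ≤ ω * ‖h‖ ^ 2)
    {Ω : Set E} (hΩ : MeasurableSet Ω) (hΩf : volume Ω ≠ ∞) {ε : ℝ≥0∞} (hε : ε ≠ 0) :
    ∃ (K : Set E) (M : ℝ) (p : E → E) (A : E → E →L[ℝ] E), volume (Ω \ K) < ε ∧ 0 ≤ M ∧
      (∀ k ∈ K, ∀ h, |⟪A k h, h⟫| ≤ M * ‖h‖ ^ 2) ∧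
      ∀ ω > 0, ∃ δ > 0, ∀ k ∈ K, ∀ h : E, ‖h‖ ≤ δ →
        |taylorRemainder u k (p k) (A k) h| ≤ ω * ‖h‖ ^ 2 := by
  classical
  let T : Set E := {x | ∃ (p : E) (A : E →L[ℝ] E), ∀ ω > 0, ∃ δ > 0, ∀ h : E, ‖h‖ ≤ δ →
      |taylorRemainder u x p A h| ≤ ω * ‖h‖ ^ 2}
  have hT0 : volume Tᶜ = 0 := hT
  let c : ℕ → ℝ := fun j => 1 / ((j : ℝ) + 1)
  have hc : ∀ j, 0 < c j := fun j => by positivity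
  obtain ⟨ε', hε'0, hε'⟩ := ENNReal.exists_pos_sum_of_countable' hε ℕ
  have hN : ∀ j, ∃ N, volume (Ω \ taylorSet u (c j) N) < ε' j := by
    intro j
    have hanti : Antitone fun N => Ω \ taylorSet u (c j) N := fun N N' h =>
      sdiff_subset_sdiff_right (taylorSet_mono u (c j) h)
    have hlim := tendsto_measure_iInter_atTop (μ := volume)
      (fun N => (hΩ.diff (isClosed_taylorSet hu (c j) N).measurableSet).nullMeasurableSet) hanti
      ⟨0, measure_ne_top_of_subset sdiff_subset hΩf⟩
    have hzero : volume (⋂ N, Ω \ taylorSet u (c j) N) = 0 := by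
      refine measure_mono_null (fun x hx => ?_) hT0
      rintro ⟨p, A, hpA⟩
      obtain ⟨δ, hδ, hδA⟩ := hpA (c j) (hc j)
      obtain ⟨N, hN⟩ := exists_nat_ge (max (max ‖p‖ ‖A‖) δ⁻¹)
      have hNp : ‖p‖ ≤ N := ((le_max_left _ _).trans (le_max_left _ _)).trans hN
      have hNA : ‖A‖ ≤ N := ((le_max_right _ _).trans (le_max_left _ _)).trans hN
      have hNδ : δ⁻¹ ≤ N := (le_max_right _ _).trans hN
      refine (mem_iInter.1 hx N).2 ⟨p, A, hNp, hNA, fun h hh => hδA h (hh.trans ?_)⟩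
      rw [div_le_iff₀ (by positivity)]
      have := mul_le_mul_of_nonneg_left hNδ hδ.le
      rw [mul_inv_cancel₀ hδ.ne'] at this
      nlinarith
    rw [hzero] at hlim
    exact (hlim.eventually_lt_const (hε'0 j)).exists
  choose N hN using hN
  let p : E → E := fun x => if h : x ∈ T then h.choose else 0
  let A : E → E →L[ℝ] E := fun x => if h : x ∈ T then h.choose_spec.choose else 0
  have hpA : ∀ x ∈ T, ∀ ω > 0, ∃ δ > 0, ∀ h : E, ‖h‖ ≤ δ →
      |taylorRemainder u x (p x) (A x) h| ≤ ω * ‖h‖ ^ 2 := by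
    intro x hx
    simp only [p, A, dif_pos hx]
    exact hx.choose_spec.choose_spec
  let K : Set E := Ω ∩ ((⋂ j, taylorSet u (c j) (N j)) ∩ T)
  refine ⟨K, N 0 + 2, p, A, ?_, by positivity, ?_, ?_⟩
  · have hsub : Ω \ K ⊆ (⋃ j, Ω \ taylorSet u (c j) (N j)) ∪ Tᶜ := by
      rintro x ⟨hxΩ, hxK⟩
      by_contra hcon
      simp only [mem_union, mem_iUnion, Set.mem_sdiff, mem_compl_iff, not_or, not_exists, not_and,
        not_not] at hcon
      exact hxK ⟨hxΩ, mem_iInter.2 fun j => hcon.1 j hxΩ, hcon.2⟩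
    calc volume (Ω \ K) ≤ volume (⋃ j, Ω \ taylorSet u (c j) (N j)) + volume Tᶜ :=
          (measure_mono hsub).trans (measure_union_le _ _)
      _ ≤ ∑' j, volume (Ω \ taylorSet u (c j) (N j)) := by
          rw [hT0, add_zero]; exact measure_iUnion_le _
      _ ≤ ∑' j, ε' j := ENNReal.tsum_le_tsum fun j => (hN j).le
      _ < ε := hε'
  · rintro k ⟨_, hk, hkT⟩ h
    obtain ⟨q, B, hq, hB, hqB⟩ := mem_iInter.1 hk 0
    have h1 := (inner_sub_eq_zero_and_abs_le (by positivity) (hpA k hkT) hqB h).2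
    have h2 : |⟪B h, h⟫| ≤ N 0 * ‖h‖ ^ 2 := by
      calc _ ≤ ‖B h‖ * ‖h‖ := abs_real_inner_le_norm _ _
        _ ≤ N 0 * ‖h‖ * ‖h‖ := by
          gcongr; exact (B.le_opNorm h).trans (by gcongr)
        _ = _ := by ring
    simp only [c, Nat.cast_zero, zero_add, div_one, one_mul, _root_.sub_apply,
      inner_sub_left] at h1
    rw [abs_le] at h1 h2 ⊢
    constructor <;> linarith
  · intro ω hω
    obtain ⟨j, hj⟩ := exists_nat_one_div_lt (half_pos hω)
    refine ⟨1 / ((N j : ℝ) + 1), by positivity, ?_⟩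
    rintro k ⟨_, hk, hkT⟩ h hh
    obtain ⟨q, B, hq, hB, hqB⟩ := mem_iInter.1 hk j
    have h1 := inner_sub_eq_zero_and_abs_le (by positivity) (hpA k hkT) hqB h
    rw [taylorRemainder_eq_add u k (p k) q (A k) B h, h1.1, zero_add]
    calc _ ≤ |taylorRemainder u k q B h| + |1 / 2 * ⟪(B - A k) h, h⟫| := abs_add_le _ _
      _ ≤ c j * ‖h‖ ^ 2 + c j * ‖h‖ ^ 2 := add_le_add (hqB h hh) h1.2
      _ = 2 * c j * ‖h‖ ^ 2 := by ring
      _ ≤ ω * ‖h‖ ^ 2 := by gcongr; linarith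

end UniformTaylor

section Mollify

open scoped RealInnerProductSpace Topology NNReal Convolution ContDiff

variable {E : Type*} [NormedAddCommGroup E] [InnerProductSpace ℝ E] [FiniteDimensional ℝ E]
  [MeasurableSpace E] [BorelSpace E]

/-- A fixed even smooth probability density supported in the unit ball. -/
noncomputable def mollifier (E : Type*) [NormedAddCommGroup E] [InnerProductSpace ℝ E]
    [FiniteDimensional ℝ E] [MeasurableSpace E] [BorelSpace E] : E → ℝ :=
  (⟨1 / 2, 1, by norm_num, by norm_num⟩ : ContDiffBump (0 : E)).normed volume

lemma contDiff_mollifier {n : ℕ∞} : ContDiff ℝ n (mollifier E) := ContDiffBump.contDiff_normed _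

lemma hasCompactSupport_mollifier : HasCompactSupport (mollifier E) :=
  ContDiffBump.hasCompactSupport_normed _

lemma mollifier_nonneg (y : E) : 0 ≤ mollifier E y := ContDiffBump.nonneg_normed _ _

lemma mollifier_neg (y : E) : mollifier E (-y) = mollifier E y := ContDiffBump.normed_neg _ _

lemma integral_mollifier : ∫ y, mollifier E y = 1 := ContDiffBump.integral_normed _

lemma continuous_mollifier : Continuous (mollifier E) := ContDiffBump.continuous_normed _

lemma mollifier_eq_zero {y : E} (hy : 1 ≤ ‖y‖) : mollifier E y = 0 := by
  have h := ContDiffBump.support_normed_eq (μ := volume)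
    (⟨1 / 2, 1, by norm_num, by norm_num⟩ : ContDiffBump (0 : E))
  by_contra hne
  have : y ∈ Function.support (mollifier E) := hne
  rw [mollifier, h, mem_ball_zero_iff] at this
  exact absurd this (not_lt.2 hy)

/-- The average of `f` around `x` at scale `ρ`. -/
noncomputable def mollify (ρ : ℝ) (f : E → ℝ) (x : E) : ℝ :=
  ∫ y, mollifier E y * f (x - ρ • y)

lemma integrable_mollifier_mul {g : E → ℝ} (hg : Continuous g) :
    Integrable fun y => mollifier E y * g y :=
  (continuous_mollifier.mul hg).integrable_of_hasCompactSupport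
    hasCompactSupport_mollifier.mul_right

lemma integrable_mollify {f : E → ℝ} (hf : Continuous f) (ρ : ℝ) (x : E) :
    Integrable fun y => mollifier E y * f (x - ρ • y) :=
  integrable_mollifier_mul (by fun_prop)

lemma mollify_congr {f g : E → ℝ} {ρ : ℝ} (hρ : 0 ≤ ρ) {x : E}
    (h : ∀ z ∈ closedBall x ρ, f z = g z) : mollify ρ f x = mollify ρ g x := by
  refine integral_congr_ae (Eventually.of_forall fun y => ?_)
  rcases le_or_gt 1 ‖y‖ with hy | hy
  · simp [mollifier_eq_zero hy]
  · dsimp only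
    rw [h]
    rw [mem_closedBall, dist_eq_norm, sub_sub_cancel_left, norm_neg, norm_smul, Real.norm_eq_abs,
      abs_of_nonneg hρ]
    exact mul_le_of_le_one_right hρ hy.le

lemma mollify_const (ρ c : ℝ) (x : E) : mollify ρ (fun _ => c) x = c := by
  simp [mollify, integral_mul_const, integral_mollifier]

lemma mollify_sub {f g : E → ℝ} (hf : Continuous f) (hg : Continuous g) (ρ : ℝ) (x : E) :
    mollify ρ (fun z => f z - g z) x = mollify ρ f x - mollify ρ g x := by
  simp only [mollify, mul_sub]
  exact integral_sub (integrable_mollify hf ρ x) (integrable_mollify hg ρ x)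

lemma mollify_eq_convolution {ρ : ℝ} (hρ : 0 < ρ) (f : E → ℝ) (x : E) :
    mollify ρ f x = ((fun t => (ρ ^ Module.finrank ℝ E)⁻¹ * mollifier E (ρ⁻¹ • t))
      ⋆[ContinuousLinearMap.lsmul ℝ ℝ, volume] f) x := by
  have h := Measure.integral_comp_smul (volume : Measure E)
    (fun t => mollifier E (ρ⁻¹ • t) * f (x - t)) ρ
  rw [abs_of_pos (by positivity), smul_eq_mul] at h
  simp only [convolution_def, ContinuousLinearMap.lsmul_apply, smul_eq_mul, mul_assoc,
    integral_const_mul]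
  rw [← h]
  simp only [mollify, inv_smul_smul₀ hρ.ne']

lemma contDiff_mollify_param {n : ℕ∞} {f : E → ℝ} (hf : Continuous f) {s : E → ℝ} {r : ℝ}
    (hs : ContDiff ℝ n s) (hpos : ∀ x, 0 < s x) (hle : ∀ x, s x ≤ r) :
    ContDiff ℝ n fun x => mollify (s x) f x := by
  have hfun : (fun x => mollify (s x) f x) = fun x =>
      ((fun t => (s x ^ Module.finrank ℝ E)⁻¹ * mollifier E ((s x)⁻¹ • t))
        ⋆[ContinuousLinearMap.lsmul ℝ ℝ, volume] f) x :=
    funext fun x => mollify_eq_convolution (hpos x) f x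
  rw [hfun, ← contDiffOn_univ]
  refine contDiffOn_convolution_left_with_param_comp (k := closedBall 0 r)
    (g := fun x t => (s x ^ Module.finrank ℝ E)⁻¹ * mollifier E ((s x)⁻¹ • t))
    (ContinuousLinearMap.lsmul ℝ ℝ) contDiffOn_id isOpen_univ
    (isCompact_closedBall 0 r) ?_ hf.locallyIntegrable ?_
  · intro x t _ ht
    rw [mollifier_eq_zero, mul_zero]
    rw [mem_closedBall_zero_iff, not_le] at ht
    rw [norm_smul, norm_inv, Real.norm_eq_abs, abs_of_pos (hpos x), ← div_eq_inv_mul,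
      one_le_div (hpos x)]
    exact (hle x).trans ht.le
  · rw [univ_prod_univ, contDiffOn_univ]
    have h1 : ContDiff ℝ n fun q : E × E => s q.1 := hs.comp contDiff_fst
    have h2 : ContDiff ℝ n fun q : E × E => (s q.1)⁻¹ := h1.inv fun q => (hpos _).ne'
    exact ((h1.pow _).inv fun q => (pow_pos (hpos _) _).ne').mul
      (contDiff_mollifier.comp (h2.smul contDiff_snd))

lemma contDiff_mollify {n : ℕ∞} {f : E → ℝ} (hf : Continuous f) {ρ : ℝ} (hρ : 0 < ρ) :
    ContDiff ℝ n (mollify ρ f) :=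
  contDiff_mollify_param hf contDiff_const (fun _ => hρ) (fun _ => le_rfl)

lemma norm_convolution_le_of_support {F G : Type*} [NormedAddCommGroup F] [NormedSpace ℝ F]
    [NormedAddCommGroup G] [NormedSpace ℝ G] (L : F →L[ℝ] ℝ →L[ℝ] G) {g : E → F}
    (hg : Continuous g) (hcg : HasCompactSupport g) (hg1 : ∀ t, 1 < ‖t‖ → g t = 0) {f : E → ℝ}
    {x : E} {B : ℝ} (hB : ∀ z ∈ closedBall x 1, |f z| ≤ B) :
    ‖(g ⋆[L, volume] f) x‖ ≤ ‖L‖ * (∫ t, ‖g t‖) * B := by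
  rw [convolution_def, mul_comm ‖L‖, mul_assoc, ← integral_mul_const]
  refine norm_integral_le_of_norm_le ((hg.norm.integrable_of_hasCompactSupport hcg.norm).mul_const _)
    (Eventually.of_forall fun t => ?_)
  rcases lt_or_ge 1 ‖t‖ with ht | ht
  · simp [hg1 t ht]
  · calc ‖L (g t) (f (x - t))‖ ≤ ‖L‖ * ‖g t‖ * ‖f (x - t)‖ := L.le_opNorm₂ _ _
      _ ≤ ‖L‖ * ‖g t‖ * B := by
        gcongr
        exact hB _ (by simpa [mem_closedBall, dist_eq_norm] using ht)
      _ = ‖g t‖ * (‖L‖ * B) := by ring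

lemma mollify_one_eq_convolution (f : E → ℝ) :
    mollify 1 f = mollifier E ⋆[ContinuousLinearMap.lsmul ℝ ℝ, volume] f := by
  funext x
  rw [mollify_eq_convolution one_pos]
  simp

lemma exists_norm_convolution_le {F G : Type*} [NormedAddCommGroup F] [NormedSpace ℝ F]
    [NormedAddCommGroup G] [NormedSpace ℝ G] (L : F →L[ℝ] ℝ →L[ℝ] G) {g : E → F}
    (hg : Continuous g) (hcg : HasCompactSupport g) (hg1 : ∀ t, 1 < ‖t‖ → g t = 0) :
    ∃ C, 0 ≤ C ∧ ∀ (f : E → ℝ) (x : E) (B : ℝ), (∀ z ∈ closedBall x 1, |f z| ≤ B) →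
      ‖(g ⋆[L, volume] f) x‖ ≤ C * B :=
  ⟨‖L‖ * ∫ t, ‖g t‖, mul_nonneg (ContinuousLinearMap.opNorm_nonneg L) (integral_nonneg fun _ => norm_nonneg _),
    fun _ _ _ hB => norm_convolution_le_of_support L hg hcg hg1 hB⟩

lemma fderiv_eq_zero_of_support {F : Type*} [NormedAddCommGroup F] [NormedSpace ℝ F] {g : E → F}
    (hg : ∀ t, 1 < ‖t‖ → g t = 0) {t : E} (ht : 1 < ‖t‖) : fderiv ℝ g t = 0 := by
  have : g =ᶠ[𝓝 t] fun _ => 0 :=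
    (continuous_norm.tendsto t).eventually_const_lt ht |>.mono fun z hz => hg z hz
  rw [this.fderiv_eq, fderiv_const_apply]

lemma fderiv_convolution_left {F G : Type*} [NormedAddCommGroup F] [NormedSpace ℝ F]
    [NormedAddCommGroup G] [NormedSpace ℝ G] (L : F →L[ℝ] ℝ →L[ℝ] G) {g : E → F}
    (hg : ContDiff ℝ 1 g) (hcg : HasCompactSupport g) {f : E → ℝ} (hf : Continuous f) :
    fderiv ℝ (g ⋆[L, volume] f) = fderiv ℝ g ⋆[L.precompL E, volume] f :=
  funext fun x => (hcg.hasFDerivAt_convolution_left L hg hf.locallyIntegrable x).fderiv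

lemma exists_norm_fderiv_convolution_le {F G : Type*} [NormedAddCommGroup F] [NormedSpace ℝ F]
    [NormedAddCommGroup G] [NormedSpace ℝ G] (L : F →L[ℝ] ℝ →L[ℝ] G) {g : E → F}
    (hg : ContDiff ℝ 1 g) (hcg : HasCompactSupport g) (hg1 : ∀ t, 1 < ‖t‖ → g t = 0) :
    ∃ C, 0 ≤ C ∧ ∀ f : E → ℝ, Continuous f → ∀ (x : E) (B : ℝ),
      (∀ z ∈ closedBall x 1, |f z| ≤ B) → ‖fderiv ℝ (g ⋆[L, volume] f) x‖ ≤ C * B := by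
  obtain ⟨C, h, hC⟩ := exists_norm_convolution_le (L.precompL E) (hg.continuous_fderiv one_ne_zero)
    (hcg.fderiv ℝ) fun t ht => fderiv_eq_zero_of_support hg1 ht
  refine ⟨C, h, fun f hf x B hB => ?_⟩
  rw [fderiv_convolution_left L hg hcg hf]
  exact hC f x B hB

lemma exists_norm_fderiv_fderiv_convolution_le {F G : Type*} [NormedAddCommGroup F]
    [NormedSpace ℝ F] [NormedAddCommGroup G] [NormedSpace ℝ G] (L : F →L[ℝ] ℝ →L[ℝ] G)
    {g : E → F} (hg : ContDiff ℝ 2 g) (hcg : HasCompactSupport g)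
    (hg1 : ∀ t, 1 < ‖t‖ → g t = 0) :
    ∃ C, 0 ≤ C ∧ ∀ f : E → ℝ, Continuous f → ∀ (x : E) (B : ℝ),
      (∀ z ∈ closedBall x 1, |f z| ≤ B) →
        ‖fderiv ℝ (fderiv ℝ (g ⋆[L, volume] f)) x‖ ≤ C * B := by
  obtain ⟨C, h, hC⟩ := exists_norm_fderiv_convolution_le (L.precompL E)
    (hg.fderiv_right (m := 1) (by norm_num)) (hcg.fderiv ℝ)
    fun t ht => fderiv_eq_zero_of_support hg1 ht
  refine ⟨C, h, fun f hf x B hB => ?_⟩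
  rw [fderiv_convolution_left L (hg.of_le (by norm_num)) hcg hf]
  exact hC f hf x B hB

lemma exists_norm_iteratedFDeriv_mollify_one_le (E : Type*) [NormedAddCommGroup E]
    [InnerProductSpace ℝ E] [FiniteDimensional ℝ E] [MeasurableSpace E] [BorelSpace E] :
    ∃ C : ℝ, ∀ i ≤ 2, ∀ f : E → ℝ, Continuous f → ∀ x B, (∀ z ∈ closedBall x 1, |f z| ≤ B) →
      ‖iteratedFDeriv ℝ i (mollify 1 f) x‖ ≤ C * B := by
  have hc0 : HasCompactSupport (mollifier E) := hasCompactSupport_mollifier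
  have hs0 : ∀ t : E, 1 < ‖t‖ → mollifier E t = 0 := fun t ht => mollifier_eq_zero ht.le
  obtain ⟨C0, h0, hC0⟩ := exists_norm_convolution_le (ContinuousLinearMap.lsmul ℝ ℝ : ℝ →L[ℝ] ℝ →L[ℝ] ℝ)
    (continuous_mollifier (E := E)) hc0 hs0
  obtain ⟨C1, h1, hC1⟩ := exists_norm_fderiv_convolution_le (ContinuousLinearMap.lsmul ℝ ℝ : ℝ →L[ℝ] ℝ →L[ℝ] ℝ)
    (contDiff_mollifier (E := E) (n := 1)) hc0 hs0
  obtain ⟨C2, h2, hC2⟩ := exists_norm_fderiv_fderiv_convolution_le (ContinuousLinearMap.lsmul ℝ ℝ : ℝ →L[ℝ] ℝ →L[ℝ] ℝ)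
    (contDiff_mollifier (E := E) (n := 2)) hc0 hs0
  refine ⟨C0 + C1 + C2, fun i hi f hf x B hB => ?_⟩
  have hB0 : 0 ≤ B := (abs_nonneg _).trans (hB x (mem_closedBall_self zero_le_one))
  interval_cases i
  · rw [norm_iteratedFDeriv_zero, mollify_one_eq_convolution]
    refine (hC0 f x B hB).trans (mul_le_mul_of_nonneg_right ?_ hB0)
    linarith
  · rw [norm_iteratedFDeriv_one, mollify_one_eq_convolution]
    refine (hC1 f hf x B hB).trans (mul_le_mul_of_nonneg_right ?_ hB0)
    linarith
  · rw [← norm_iteratedFDeriv_fderiv, norm_iteratedFDeriv_one, mollify_one_eq_convolution]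
    refine (hC2 f hf x B hB).trans (mul_le_mul_of_nonneg_right ?_ hB0)
    linarith

lemma mollify_eq_comp_smul {ρ : ℝ} (hρ : 0 < ρ) (f : E → ℝ) :
    mollify ρ f = fun x => mollify 1 (fun w => f (ρ • w)) (ρ⁻¹ • x) := by
  funext x
  simp [mollify, smul_sub, smul_inv_smul₀ hρ.ne']

/-- Derivatives up to order two of an average at scale `ρ`. -/
lemma exists_norm_iteratedFDeriv_mollify_le (E : Type*) [NormedAddCommGroup E]
    [InnerProductSpace ℝ E] [FiniteDimensional ℝ E] [MeasurableSpace E] [BorelSpace E] :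
    ∃ C > 0, ∀ i ≤ 2, ∀ f : E → ℝ, Continuous f → ∀ ρ > 0, ∀ x B,
      (∀ z ∈ closedBall x ρ, |f z| ≤ B) →
      ‖iteratedFDeriv ℝ i (mollify ρ f) x‖ ≤ C * B / ρ ^ i := by
  obtain ⟨C, hC⟩ := exists_norm_iteratedFDeriv_mollify_one_le E
  refine ⟨|C| + 1, by positivity, fun i hi f hf ρ hρ x B hB => ?_⟩
  have hB0 : 0 ≤ B := (abs_nonneg _).trans (hB x (mem_closedBall_self hρ.le))
  have hfc : Continuous fun w => f (ρ • w) := by fun_prop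
  rw [mollify_eq_comp_smul hρ, iteratedFDeriv_comp_const_smul ρ⁻¹
    (contDiff_mollify (n := i) hfc one_pos), norm_smul, norm_pow, norm_inv, Real.norm_eq_abs,
    abs_of_pos hρ, inv_pow, ← div_eq_inv_mul]
  have := hC i hi _ hfc (ρ⁻¹ • x) B fun z hz => hB _ (by
    rw [mem_closedBall, dist_eq_norm] at hz ⊢
    have : ρ • z - x = ρ • (z - ρ⁻¹ • x) := by rw [smul_sub, smul_inv_smul₀ hρ.ne']
    rw [this, norm_smul, Real.norm_eq_abs, abs_of_pos hρ]
    exact mul_le_of_le_one_right hρ.le hz)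
  gcongr
  refine this.trans ?_
  gcongr
  linarith [le_abs_self C]

/-- The second order polynomial with value `a`, gradient `p` and Hessian `A` at `k`. -/
noncomputable def quadratic {E : Type*} [NormedAddCommGroup E] [InnerProductSpace ℝ E]
    (a : ℝ) (k p : E) (A : E →L[ℝ] E) (z : E) : ℝ :=
  a + ⟪p, z - k⟫ + 1 / 2 * ⟪A (z - k), z - k⟫

lemma contDiff_quadratic {E : Type*} [NormedAddCommGroup E] [InnerProductSpace ℝ E] {n : ℕ∞ω}
    (a : ℝ) (k p : E) (A : E →L[ℝ] E) :
    ContDiff ℝ n (quadratic a k p A) := by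
  unfold quadratic
  have h : ContDiff ℝ n fun z : E => z - k := contDiff_id.sub contDiff_const
  exact (contDiff_const.add (contDiff_const.inner ℝ h)).add
    (contDiff_const.mul ((A.contDiff.comp h).inner ℝ h))

lemma mollify_quadratic (ρ a : ℝ) (k p : E) (A : E →L[ℝ] E) (x : E) :
    mollify ρ (quadratic a k p A) x = quadratic a k p A x +
      ρ ^ 2 * (1 / 2 * ∫ y, mollifier E y * ⟪A y, y⟫) := by
  have hodd : ∫ y, mollifier E y * (⟪p, y⟫ + 1 / 2 * (⟪A (x - k), y⟫ + ⟪A y, x - k⟫)) = 0 := by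
    have h := integral_neg_eq_self
      (fun y => mollifier E y * (⟪p, y⟫ + 1 / 2 * (⟪A (x - k), y⟫ + ⟪A y, x - k⟫))) volume
    have h2 : (fun y => mollifier E (-y) *
        (⟪p, -y⟫ + 1 / 2 * (⟪A (x - k), -y⟫ + ⟪A (-y), x - k⟫))) = fun y =>
        -(mollifier E y * (⟪p, y⟫ + 1 / 2 * (⟪A (x - k), y⟫ + ⟪A y, x - k⟫))) := by
      funext y
      simp only [mollifier_neg, inner_neg_right, map_neg, inner_neg_left]
      ring
    rw [h2, integral_neg] at h
    linarith
  have hfun : ∀ y, mollifier E y * quadratic a k p A (x - ρ • y) =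
      mollifier E y * quadratic a k p A x -
      ρ * (mollifier E y * (⟪p, y⟫ + 1 / 2 * (⟪A (x - k), y⟫ + ⟪A y, x - k⟫))) +
      ρ ^ 2 * (1 / 2 * (mollifier E y * ⟪A y, y⟫)) := by
    intro y
    have : x - ρ • y - k = (x - k) - ρ • y := by abel
    simp only [quadratic, this, map_sub, map_smul, inner_sub_left, inner_sub_right,
      inner_smul_left, inner_smul_right, conj_trivial]
    ring
  have hi1 : Integrable fun y => mollifier E y * quadratic a k p A x :=
    integrable_mollifier_mul continuous_const
  have hi2 : Integrable fun y =>
      mollifier E y * (⟪p, y⟫ + 1 / 2 * (⟪A (x - k), y⟫ + ⟪A y, x - k⟫)) :=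
    integrable_mollifier_mul (by fun_prop)
  have hi3 : Integrable fun y => mollifier E y * ⟪A y, y⟫ :=
    integrable_mollifier_mul (by fun_prop)
  simp only [mollify, hfun]
  have hi12 : Integrable fun y => mollifier E y * quadratic a k p A x -
      ρ * (mollifier E y * (⟪p, y⟫ + 1 / 2 * (⟪A (x - k), y⟫ + ⟪A y, x - k⟫))) :=
    hi1.sub (hi2.const_mul ρ)
  rw [integral_add hi12 ((hi3.const_mul _).const_mul _),
    integral_sub hi1 (hi2.const_mul _), integral_const_mul, integral_const_mul,
    integral_const_mul, hodd, integral_mul_const, integral_mollifier]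
  ring

lemma abs_integral_mollifier_mul_inner_le {A : E →L[ℝ] E} {M : ℝ}
    (hA : ∀ h, |⟪A h, h⟫| ≤ M * ‖h‖ ^ 2) : |∫ y, mollifier E y * ⟪A y, y⟫| ≤ |M| := by
  have hi : Integrable fun y : E => mollifier E y * |M| := integrable_mollifier_mul continuous_const
  have h := norm_integral_le_of_norm_le (f := fun y => mollifier E y * ⟪A y, y⟫) hi
    (Eventually.of_forall fun y => ?_)
  · rwa [integral_mul_const, integral_mollifier, one_mul] at h
  · rcases le_or_gt 1 ‖y‖ with hy | hy
    · simp [mollifier_eq_zero hy]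
    · rw [norm_mul, Real.norm_eq_abs, Real.norm_eq_abs, abs_of_nonneg (mollifier_nonneg y)]
      refine mul_le_mul_of_nonneg_left ((hA y).trans ?_) (mollifier_nonneg y)
      calc M * ‖y‖ ^ 2 ≤ |M| * ‖y‖ ^ 2 := by gcongr; exact le_abs_self M
        _ ≤ |M| * 1 := by gcongr; exact pow_le_one₀ (norm_nonneg _) hy.le
        _ = |M| := mul_one _

end Mollify

section Jet

open scoped RealInnerProductSpace Topology NNReal ContDiff

variable {E : Type*} [NormedAddCommGroup E] [InnerProductSpace ℝ E]

/-- The second derivative of `v` at `x`, as a quadratic form. -/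
noncomputable def hessianForm (v : E → ℝ) (x e : E) : ℝ := iteratedFDeriv ℝ 2 v x fun _ => e

lemma iteratedDeriv_line {n : ℕ} {v : E → ℝ} (hv : ContDiff ℝ n v) (x e : E) (t : ℝ) :
    iteratedDeriv n (fun s : ℝ => v (x + s • e)) t = iteratedFDeriv ℝ n v (x + t • e) fun _ => e := by
  have hv' : ContDiff ℝ n fun z => v (x + z) := by fun_prop
  have h := (ContinuousLinearMap.toSpanSingleton ℝ e).iteratedFDeriv_comp_right (f := fun z => v (x + z)) (n := n)
    hv' t le_rfl
  have h2 : ((fun z => v (x + z)) ∘ ContinuousLinearMap.toSpanSingleton ℝ e) =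
      fun s : ℝ => v (x + s • e) := by
    funext s
    simp
  rw [iteratedDeriv_eq_iteratedFDeriv, ← h2, h]
  simp [iteratedFDeriv_comp_add_left, ContinuousMultilinearMap.compContinuousLinearMap_apply]

lemma tendsto_second_difference {v : E → ℝ} (hv : ContDiff ℝ 2 v) (x e : E) :
    Tendsto (fun t : ℝ => (v (x + t • e) + v (x - t • e) - 2 * v x) / t ^ 2) (𝓝[>] 0)
      (𝓝 (hessianForm v x e)) := by
  set φ : ℝ → ℝ := fun s => v (x + s • e) with hφ
  have hφc : ContDiff ℝ (2 : ℕ) φ := by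
    have : ContDiff ℝ (2 : ℕ) v := hv
    fun_prop
  have hT := Real.taylor_tendsto (x₀ := 0) convex_univ (mem_univ _) hφc.contDiffOn
  rw [nhdsWithin_univ] at hT
  have hneg : Tendsto (fun t : ℝ => -t) (𝓝[>] 0) (𝓝 0) := by
    have : Tendsto (fun t : ℝ => -t) (𝓝 0) (𝓝 (-0)) := continuous_neg.tendsto 0
    rw [neg_zero] at this
    exact this.mono_left nhdsWithin_le_nhds
  have hlim := ((hT.mono_left nhdsWithin_le_nhds).add (hT.comp hneg)).add_const (hessianForm v x e)
  rw [add_zero, zero_add] at hlim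
  refine hlim.congr' ?_
  filter_upwards [self_mem_nhdsWithin] with t ht
  have ht0 : t ≠ 0 := (show 0 < t from ht).ne'
  have h2 : iteratedDeriv 2 φ 0 = hessianForm v x e := by
    have := iteratedDeriv_line (n := 2) hv x e 0
    rw [zero_smul, add_zero] at this
    exact this
  simp only [Function.comp_apply, taylorWithinEval_succ, taylor_within_zero_eval,
    iteratedDerivWithin_univ, Nat.reduceAdd, h2]
  have h3 : φ 0 = v x := by simp [hφ]
  have h4 : φ (-t) = v (x - t • e) := by simp [hφ, sub_eq_add_neg]
  rw [h3, h4]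
  simp only [hφ]
  simp
  field_simp
  ring

lemma le_hessianForm {v : E → ℝ} (hv : ContDiff ℝ 2 v) {x e : E} {c : ℝ}
    (h : ∀ᶠ t in 𝓝[>] (0 : ℝ), c * t ^ 2 ≤ v (x + t • e) + v (x - t • e) - 2 * v x) :
    c ≤ hessianForm v x e := by
  refine ge_of_tendsto (tendsto_second_difference hv x e) ?_
  filter_upwards [h, self_mem_nhdsWithin] with t ht ht0
  exact (le_div_iff₀ (pow_pos ht0 2)).2 ht

lemma hessianForm_quadratic (a : ℝ) (k p : E) (A : E →L[ℝ] E) (x e : E) :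
    hessianForm (quadratic a k p A) x e = ⟪A e, e⟫ := by
  refine tendsto_nhds_unique (tendsto_second_difference (contDiff_quadratic a k p A) x e)
    (tendsto_const_nhds.congr' ?_)
  filter_upwards [self_mem_nhdsWithin] with t ht
  have ht0 : t ≠ 0 := (show 0 < t from ht).ne'
  have h1 : x + t • e - k = (x - k) + t • e := by abel
  have h2 : x - t • e - k = (x - k) - t • e := by abel
  simp only [quadratic, h1, h2, map_add, map_sub, map_smul, inner_add_left, inner_add_right,
    inner_sub_left, inner_sub_right, inner_smul_left, inner_smul_right, conj_trivial]
  field_simp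
  ring

lemma abs_hessianForm_le (v : E → ℝ) (x e : E) :
    |hessianForm v x e| ≤ ‖iteratedFDeriv ℝ 2 v x‖ * ‖e‖ ^ 2 := by
  have := (iteratedFDeriv ℝ 2 v x).le_opNorm fun _ => e
  simpa [hessianForm] using this

lemma hessianForm_sub {v w : E → ℝ} (hv : ContDiff ℝ 2 v) (hw : ContDiff ℝ 2 w) (x e : E) :
    hessianForm (v - w) x e = hessianForm v x e - hessianForm w x e := by
  simp only [hessianForm]
  rw [iteratedFDeriv_sub_apply hv.contDiffAt hw.contDiffAt]
  rfl

lemma hessianForm_congr {v w : E → ℝ} {x : E} (h : v =ᶠ[𝓝 x] w) (e : E) :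
    hessianForm v x e = hessianForm w x e := by
  simp only [hessianForm, (h.iteratedFDeriv ℝ 2).self_of_nhds]

/-- A bound on the derivatives up to order two of `f` at `x` at length scale `d`. -/
def JetLE (b d : ℝ) (f : E → ℝ) (x : E) : Prop :=
  ∀ i ≤ 2, ‖iteratedFDeriv ℝ i f x‖ ≤ b * d ^ 2 / d ^ i

lemma JetLE.mono {b b' d : ℝ} (hd : 0 ≤ d) (hb : b ≤ b') {f : E → ℝ} {x : E} (h : JetLE b d f x) :
    JetLE b' d f x := fun i hi => (h i hi).trans (by gcongr)

lemma JetLE.scale_mono {b d d' : ℝ} (hd : 0 < d) (hdd : d ≤ d') (hb : 0 ≤ b) {f : E → ℝ} {x : E}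
    (h : JetLE b d f x) : JetLE b d' f x := by
  intro i hi
  refine (h i hi).trans ?_
  have key : ∀ r : ℝ, 0 < r → b * r ^ 2 / r ^ i = b * r ^ (2 - i) := fun r hr => by
    rw [mul_div_assoc, pow_sub₀ r hr.ne' hi, div_eq_mul_inv]
  rw [key d hd, key d' (hd.trans_le hdd)]
  gcongr

lemma JetLE.double_scale {b d : ℝ} (hd : 0 < d) (hb : 0 ≤ b) {f : E → ℝ} {x : E}
    (h : JetLE b (2 * d) f x) : JetLE (4 * b) d f x := by
  intro i hi
  refine (h i hi).trans ?_
  have h1 : (1 : ℝ) ≤ 2 ^ i := one_le_pow₀ (by norm_num)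
  rw [mul_pow, mul_pow, div_le_div_iff₀ (by positivity) (by positivity)]
  calc b * (2 ^ 2 * d ^ 2) * d ^ i = 4 * b * d ^ 2 * (1 * d ^ i) := by ring
    _ ≤ 4 * b * d ^ 2 * (2 ^ i * d ^ i) := by gcongr

lemma JetLE.congr {b d : ℝ} {f g : E → ℝ} {x : E} (h : JetLE b d f x) (hfg : f =ᶠ[𝓝 x] g) :
    JetLE b d g x := fun i hi => by
  rw [← (hfg.iteratedFDeriv ℝ i).self_of_nhds]
  exact h i hi

lemma JetLE.add {b b' d : ℝ} {f g : E → ℝ} {x : E} (hf : ContDiff ℝ 2 f) (hg : ContDiff ℝ 2 g)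
    (h : JetLE b d f x) (h' : JetLE b' d g x) : JetLE (b + b') d (f + g) x := by
  intro i hi
  have hi' : (i : ℕ∞ω) ≤ 2 := by exact_mod_cast hi
  rw [iteratedFDeriv_add_apply (hf.of_le hi').contDiffAt (hg.of_le hi').contDiffAt, add_mul, add_div]
  exact (norm_add_le _ _).trans (add_le_add (h i hi) (h' i hi))

lemma JetLE.sub {b b' d : ℝ} {f g : E → ℝ} {x : E} (hf : ContDiff ℝ 2 f) (hg : ContDiff ℝ 2 g)
    (h : JetLE b d f x) (h' : JetLE b' d g x) : JetLE (b + b') d (f - g) x := by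
  intro i hi
  have hi' : (i : ℕ∞ω) ≤ 2 := by exact_mod_cast hi
  rw [iteratedFDeriv_sub_apply (hf.of_le hi').contDiffAt (hg.of_le hi').contDiffAt, add_mul, add_div]
  exact (norm_sub_le _ _).trans (add_le_add (h i hi) (h' i hi))

lemma JetLE.mul {b C d : ℝ} (hd : 0 < d) (hb : 0 ≤ b) (hC : 0 ≤ C) {χ f : E → ℝ} {x : E}
    (hχ : ContDiff ℝ 2 χ) (hf : ContDiff ℝ 2 f)
    (hχb : ∀ i ≤ 2, ‖iteratedFDeriv ℝ i χ x‖ ≤ C / d ^ i) (h : JetLE b d f x) :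
    JetLE (4 * C * b) d (fun y => χ y * f y) x := by
  intro i hi
  have hi' : (i : ℕ∞ω) ≤ 2 := by exact_mod_cast hi
  refine (norm_iteratedFDeriv_mul_le hχ hf x hi').trans ?_
  calc ∑ j ∈ Finset.range (i + 1), (i.choose j : ℝ) * ‖iteratedFDeriv ℝ j χ x‖ *
        ‖iteratedFDeriv ℝ (i - j) f x‖
      ≤ ∑ j ∈ Finset.range (i + 1), (i.choose j : ℝ) * (C * b * d ^ 2 / d ^ i) := by
        refine Finset.sum_le_sum fun j hj => ?_
        have hji : j ≤ i := Nat.lt_succ_iff.1 (Finset.mem_range.1 hj)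
        rw [mul_assoc]
        refine mul_le_mul_of_nonneg_left ?_ (Nat.cast_nonneg _)
        calc _ ≤ (C / d ^ j) * (b * d ^ 2 / d ^ (i - j)) :=
              mul_le_mul (hχb j (hji.trans hi)) (h (i - j) ((Nat.sub_le _ _).trans hi))
                (norm_nonneg _) (by positivity)
          _ = C * b * d ^ 2 / (d ^ j * d ^ (i - j)) := by field_simp
          _ = C * b * d ^ 2 / d ^ i := by rw [← pow_add, Nat.add_sub_cancel' hji]
    _ = 2 ^ i * (C * b * d ^ 2 / d ^ i) := by
        rw [← Finset.sum_mul]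
        congr 1
        exact_mod_cast Nat.sum_range_choose i
    _ ≤ 2 ^ 2 * (C * b * d ^ 2 / d ^ i) := by
        gcongr
        norm_num
    _ = 4 * C * b * d ^ 2 / d ^ i := by ring

lemma JetLE.abs_le {b d : ℝ} {f : E → ℝ} {x : E} (h : JetLE b d f x) : |f x| ≤ b * d ^ 2 := by
  simpa using h 0 (by norm_num)

lemma JetLE.abs_hessianForm_le {b d : ℝ} (hd : 0 < d) {f : E → ℝ} {x : E} (h : JetLE b d f x)
    (e : E) : |hessianForm f x e| ≤ b * ‖e‖ ^ 2 := by
  refine (_root_.abs_hessianForm_le f x e).trans ?_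
  have := h 2 le_rfl
  rw [mul_div_assoc, div_self (pow_pos hd 2).ne', mul_one] at this
  gcongr

/-- A sequence of `C²` functions whose jets are fast Cauchy converges in `C²`. -/
lemma exists_contDiff_limit {b d : ℝ}
    {v : ℕ → E → ℝ} (hv : ∀ j, ContDiff ℝ 2 (v j))
    (h : ∀ j x, JetLE (b / 2 ^ j) d (v (j + 1) - v j) x) :
    ∃ w : E → ℝ, ContDiff ℝ 2 w ∧ ∀ j x, JetLE (2 * b / 2 ^ j) d (w - v j) x := by
  have hg : ∀ j, ContDiff ℝ 2 (v (j + 1) - v j) := fun j => (hv _).sub (hv j)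
  set B : ℕ → ℕ → ℝ := fun i j => b * d ^ 2 / d ^ i * (1 / 2) ^ j with hB
  have hBeq : ∀ i j, b / 2 ^ j * d ^ 2 / d ^ i = B i j := fun i j => by
    simp only [hB, one_div, inv_pow]
    ring
  have hsum : ∀ i, Summable (B i) := fun i => summable_geometric_two.mul_left _
  have hbd : ∀ (i j : ℕ) (x : E), (i : ℕ∞) ≤ 2 → ‖iteratedFDeriv ℝ i (v (j + 1) - v j) x‖ ≤ B i j :=
    fun i j x hi => (h j x i (by exact_mod_cast hi)).trans_eq (hBeq i j)
  have hbd' : ∀ (m i j : ℕ) (x : E), (i : ℕ∞) ≤ 2 →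
      ‖iteratedFDeriv ℝ i (v (j + m + 1) - v (j + m)) x‖ ≤ B i (j + m) :=
    fun m i j x hi => hbd i (j + m) x hi
  have hcd : ∀ m, ContDiff ℝ 2 fun x => ∑' j, (v (j + m + 1) - v (j + m)) x := fun m =>
    contDiff_tsum (N := 2) (fun j => hg (j + m)) (fun i _ => (summable_nat_add_iff m).2 (hsum i))
      (hbd' m)
  have hsx : ∀ x, Summable fun j => (v (j + 1) - v j) x := fun x =>
    Summable.of_norm_bounded (hsum 0) fun j => by
      simpa using hbd 0 j x (by norm_num)
  set w : E → ℝ := fun x => v 0 x + ∑' j, (v (j + 0 + 1) - v (j + 0)) x with hw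
  have htel : ∀ m x, (w - v m) x = ∑' j, (v (j + m + 1) - v (j + m)) x := by
    intro m x
    have h1 := (hsx x).sum_add_tsum_nat_add m
    have h2 : ∑ j ∈ Finset.range m, (v (j + 1) - v j) x = v m x - v 0 x := by
      simp only [Pi.sub_apply]
      exact Finset.sum_range_sub (fun j => v j x) m
    simp only [hw, Pi.sub_apply, add_zero] at h1 h2 ⊢
    linarith
  refine ⟨w, (hv 0).add (hcd 0), fun m x i hi => ?_⟩
  have hi' : (i : ℕ∞) ≤ 2 := by exact_mod_cast hi
  rw [funext (htel m), iteratedFDeriv_tsum_apply (N := 2) (fun j => hg (j + m))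
    (fun i _ => (summable_nat_add_iff m).2 (hsum i)) (hbd' m) hi' x]
  have hs2 : HasSum (fun j => B i (j + m)) (2 * b / 2 ^ m * d ^ 2 / d ^ i) := by
    have h1 := hasSum_geometric_two.mul_left (b * d ^ 2 / d ^ i * (1 / 2) ^ m)
    have e1 : (fun j => b * d ^ 2 / d ^ i * (1 / 2) ^ m * (1 / 2) ^ j) = fun j => B i (j + m) := by
      funext j
      simp only [hB, pow_add]
      ring
    have e2 : b * d ^ 2 / d ^ i * (1 / 2) ^ m * 2 = 2 * b / 2 ^ m * d ^ 2 / d ^ i := by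
      rw [one_div, inv_pow]
      ring
    rwa [e1, e2] at h1
  exact tsum_of_norm_bounded hs2 fun j => hbd' m i j x hi'

end Jet

section GlueSequence

open scoped RealInnerProductSpace Topology NNReal ContDiff

variable {E : Type*} [NormedAddCommGroup E] [InnerProductSpace ℝ E]

/-- Smooth cutoff functions of the thickenings of a set, with derivative bounds. -/
lemma exists_cutoff (E : Type*) [NormedAddCommGroup E] [InnerProductSpace ℝ E]
    [FiniteDimensional ℝ E] :
    ∃ C, 0 ≤ C ∧ ∀ (K : Set E) (d : ℝ), 0 < d → ∃ χ : E → ℝ, ContDiff ℝ 2 χ ∧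
      (∀ x ∈ thickening (d / 2) K, χ x = 1) ∧ (∀ x ∉ cthickening (3 / 4 * d) K, χ x = 0) ∧
      ∀ i ≤ 2, ∀ x, ‖iteratedFDeriv ℝ i χ x‖ ≤ C / d ^ i := by
  let _ : MeasurableSpace E := borel E
  have : BorelSpace E := ⟨rfl⟩
  obtain ⟨C, hC0, hC⟩ := exists_norm_iteratedFDeriv_mollify_le E
  refine ⟨C * 16 ^ 2, by positivity, fun K d hd => ?_⟩
  have hd8 : 0 < d / 8 := by positivity
  have hd16 : 0 < d / 16 := by positivity
  set g : E → ℝ := fun x => (thickenedIndicator hd8 (thickening (9 / 16 * d) K) x : ℝ) with hg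
  have hgc : Continuous g := NNReal.continuous_coe.comp (thickenedIndicator hd8 _).continuous
  refine ⟨mollify (d / 16) g, contDiff_mollify (n := 2) hgc hd16, fun x hx => ?_, fun x hx => ?_,
    fun i hi x => ?_⟩
  · rw [mollify_congr (g := fun _ => 1) hd16.le, mollify_const]
    intro z hz
    have hz' : z ∈ thickening (9 / 16 * d) K := by
      rw [mem_thickening_iff] at hx ⊢
      obtain ⟨k, hk, hxk⟩ := hx
      refine ⟨k, hk, (dist_triangle z x k).trans_lt ?_⟩
      linarith [mem_closedBall.1 hz]
    simp only [hg, thickenedIndicator_one hd8 _ hz', NNReal.coe_one]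
  · rw [mollify_congr (g := fun _ => 0) hd16.le, mollify_const]
    intro z hz
    have hz' : z ∉ thickening (d / 8) (thickening (9 / 16 * d) K) := by
      intro hmem
      have h1 := thickening_thickening_subset _ _ _ hmem
      refine hx (thickening_subset_cthickening _ _ ?_)
      rw [mem_thickening_iff] at h1 ⊢
      obtain ⟨k, hk, hzk⟩ := h1
      refine ⟨k, hk, (dist_triangle x z k).trans_lt ?_⟩
      have := mem_closedBall'.1 hz
      linarith
    simp only [hg, thickenedIndicator_zero hd8 _ hz', NNReal.coe_zero]
  · have h1 := hC i hi g hgc (d / 16) hd16 x 1 fun z _ => by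
      rw [abs_of_nonneg (NNReal.coe_nonneg _)]
      exact_mod_cast thickenedIndicator_le_one hd8 _ z
    refine h1.trans ?_
    have h2 : (16 : ℝ) ^ i ≤ 16 ^ 2 := pow_le_pow_right₀ (by norm_num) hi
    rw [div_pow, div_div_eq_mul_div, mul_one]
    gcongr

/-- Functions glued successively along smaller and smaller neighbourhoods. -/
noncomputable def glueSeq (χ W : ℕ → E → ℝ) : ℕ → E → ℝ
  | 0 => W 0
  | m + 1 => glueSeq χ W m + fun x => χ m x * (W (m + 1) - glueSeq χ W m) x

lemma contDiff_glueSeq {χ W : ℕ → E → ℝ} (hχ : ∀ m, ContDiff ℝ 2 (χ m))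
    (hW : ∀ m, ContDiff ℝ 2 (W m)) (m : ℕ) : ContDiff ℝ 2 (glueSeq χ W m) := by
  induction m with
  | zero => exact hW 0
  | succ m ih => exact ih.add ((hχ m).mul ((hW (m + 1)).sub ih))

lemma glueSeq_eventuallyEq {χ W : ℕ → E → ℝ} {d : ℕ → ℝ} (hd : ∀ m, d (m + 1) = d m / 2)
    {K : Set E} (h1 : ∀ m, ∀ x ∈ thickening (d m / 2) K, χ m x = 1) (m : ℕ) {x : E}
    (hx : x ∈ thickening (d m) K) : glueSeq χ W m =ᶠ[𝓝 x] W m := by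
  filter_upwards [isOpen_thickening.mem_nhds hx] with z hz
  cases m with
  | zero => rfl
  | succ m =>
    rw [hd] at hz
    simp [glueSeq, h1 m z hz]

lemma glueSeq_eq_of_notMem {χ W : ℕ → E → ℝ} {d : ℕ → ℝ} (hd : Antitone d) {K : Set E}
    (h0 : ∀ m, ∀ x ∉ cthickening (3 / 4 * d m) K, χ m x = 0) {m m' : ℕ} (hm : m ≤ m') {x : E}
    (hx : x ∉ cthickening (3 / 4 * d m) K) : glueSeq χ W m' x = glueSeq χ W m x := by
  induction m', hm using Nat.le_induction with
  | base => rfl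
  | succ m' hm ih =>
    have hx' : x ∉ cthickening (3 / 4 * d m') K := fun hmem =>
      hx (cthickening_mono (by have := hd hm; linarith) K hmem)
    simp [glueSeq, h0 m' x hx', ih]

lemma eventually_notMem_cthickening {d : ℝ} (hd : 0 < d) {K : Set E} {x : E}
    (hx : x ∉ thickening d K) : ∀ᶠ z in 𝓝 x, z ∉ cthickening (3 / 4 * d) K :=
  isClosed_cthickening.isOpen_compl.mem_nhds fun hmem =>
    hx (cthickening_subset_thickening' hd (by linarith) K hmem)

lemma JetLE.glueSeq {χ W : ℕ → E → ℝ} (hχ : ∀ m, ContDiff ℝ 2 (χ m))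
    (hW : ∀ m, ContDiff ℝ 2 (W m)) {d : ℕ → ℝ} (hd0 : ∀ m, 0 < d m)
    (hd : ∀ m, d (m + 1) = d m / 2) {K : Set E} {C : ℝ} (hC : 0 ≤ C)
    (h1 : ∀ m, ∀ x ∈ thickening (d m / 2) K, χ m x = 1)
    (h0 : ∀ m, ∀ x ∉ cthickening (3 / 4 * d m) K, χ m x = 0)
    (hχC : ∀ m, ∀ i ≤ 2, ∀ x, ‖iteratedFDeriv ℝ i (χ m) x‖ ≤ C / d m ^ i)
    {P : E → E → ℝ} (hP : ∀ k, ContDiff ℝ 2 (P k)) {b : ℝ} (hb : 0 ≤ b) {N : ℕ}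
    (H : ∀ m ≥ N, ∀ k ∈ K, ∀ x, dist x k < d m →
      JetLE b (d m) (W m - P k) x ∧ JetLE b (d m) (W (m + 1) - P k) x)
    {m m' : ℕ} (hm : N ≤ m) (hm' : m ≤ m') {x : E} (hx : x ∈ thickening (d m) K) :
    ∃ k ∈ K, dist x k < d m ∧ JetLE ((1 + 8 * C) * b) (d m) (glueSeq χ W m' - P k) x := by
  have hanti : Antitone d := antitone_nat_of_succ_le fun m => by
    rw [hd]
    linarith [hd0 m]
  have hbase : ∀ m ≥ N, ∀ x, ∀ k ∈ K, dist x k < d m →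
      JetLE b (d m) (_root_.glueSeq χ W m - P k) x := fun m hm x k hk hxk =>
    (H m hm k hk x hxk).1.congr (by
      filter_upwards [glueSeq_eventuallyEq (W := W) hd h1 m
        (mem_thickening_iff.2 ⟨k, hk, hxk⟩)] with z hz
      simp [hz])
  have hle : b ≤ (1 + 8 * C) * b := by nlinarith [mul_nonneg hC hb]
  induction m', hm' using Nat.le_induction with
  | base =>
    obtain ⟨k, hk, hxk⟩ := mem_thickening_iff.1 hx
    exact ⟨k, hk, hxk, (hbase m hm x k hk hxk).mono (hd0 m).le hle⟩
  | succ m' hmm ih =>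
    by_cases hx' : x ∈ thickening (d m') K
    · obtain ⟨k, hk, hxk⟩ := mem_thickening_iff.1 hx'
      have hN : N ≤ m' := hm.trans hmm
      refine ⟨k, hk, hxk.trans_le (hanti hmm), JetLE.scale_mono (hd0 m') (hanti hmm)
        (hb.trans hle) ?_⟩
      have hv := contDiff_glueSeq hχ hW m'
      have j1 := hbase m' hN x k hk hxk
      have j2 := (H m' hN k hk x hxk).2
      have j3 : JetLE (b + b) (d m') (W (m' + 1) - _root_.glueSeq χ W m') x :=
        (j2.sub ((hW _).sub (hP k)) (hv.sub (hP k)) j1).congr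
          (Eventually.of_forall fun z => by simp)
      have j4 := JetLE.mul (hd0 m') (add_nonneg hb hb) hC (hχ m') ((hW (m' + 1)).sub hv)
        (fun i hi => hχC m' i hi x) j3
      have j5 := j1.add (hv.sub (hP k)) ((hχ m').mul ((hW (m' + 1)).sub hv)) j4
      have e1 : b + 4 * C * (b + b) = (1 + 8 * C) * b := by ring
      rw [e1] at j5
      refine j5.congr (Eventually.of_forall fun z => ?_)
      simp [_root_.glueSeq]
      ring
    · obtain ⟨k, hk, hxk, hj⟩ := ih
      refine ⟨k, hk, hxk, hj.congr ?_⟩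
      filter_upwards [eventually_notMem_cthickening (hd0 m') hx'] with z hz
      simp [glueSeq_eq_of_notMem (W := W) hanti h0 (Nat.le_succ m') hz]

lemma JetLE.zero_of_eventuallyEq {b d : ℝ} (hd : 0 < d) (hb : 0 ≤ b) {f : E → ℝ} {x : E}
    (h : f =ᶠ[𝓝 x] fun _ => 0) : JetLE b d f x := by
  refine JetLE.congr (f := fun _ => 0) (fun i hi => ?_) h.symm
  have : iteratedFDeriv ℝ i (fun _ : E => (0 : ℝ)) x = 0 := by
    have := iteratedFDeriv_fun_zero (𝕜 := ℝ) (E := E) (F := ℝ) (n := i)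
    exact congrFun this x
  rw [this, norm_zero]
  positivity

lemma JetLE.glueSeq_sub {χ W : ℕ → E → ℝ} (hχ : ∀ m, ContDiff ℝ 2 (χ m))
    (hW : ∀ m, ContDiff ℝ 2 (W m)) {d : ℕ → ℝ} (hd0 : ∀ m, 0 < d m)
    (hd : ∀ m, d (m + 1) = d m / 2) {K : Set E} {C : ℝ} (hC : 0 ≤ C)
    (h1 : ∀ m, ∀ x ∈ thickening (d m / 2) K, χ m x = 1)
    (h0 : ∀ m, ∀ x ∉ cthickening (3 / 4 * d m) K, χ m x = 0)
    (hχC : ∀ m, ∀ i ≤ 2, ∀ x, ‖iteratedFDeriv ℝ i (χ m) x‖ ≤ C / d m ^ i)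
    {P : E → E → ℝ} (hP : ∀ k, ContDiff ℝ 2 (P k)) {b : ℝ} (hb : 0 ≤ b) {N : ℕ}
    (H : ∀ m ≥ N, ∀ k ∈ K, ∀ x, dist x k < d m →
      JetLE b (d m) (W m - P k) x ∧ JetLE b (d m) (W (m + 1) - P k) x)
    {m m' : ℕ} (hm : N ≤ m) (hm' : m ≤ m') (x : E) :
    JetLE ((2 + 8 * C) * b) (d 0) (_root_.glueSeq χ W m' - _root_.glueSeq χ W m) x := by
  have hanti : Antitone d := antitone_nat_of_succ_le fun m => by
    rw [hd]
    linarith [hd0 m]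
  have hb' : 0 ≤ (2 + 8 * C) * b := by positivity
  by_cases hx : x ∈ thickening (d m) K
  · obtain ⟨k, hk, hxk, hj⟩ := JetLE.glueSeq hχ hW hd0 hd hC h1 h0 hχC hP hb H hm hm' hx
    have j1 : JetLE b (d m) (_root_.glueSeq χ W m - P k) x := (H m hm k hk x hxk).1.congr (by
      filter_upwards [glueSeq_eventuallyEq (W := W) hd h1 m hx] with z hz
      simp [hz])
    have j2 : JetLE ((1 + 8 * C) * b + b) (d m)
        (_root_.glueSeq χ W m' - _root_.glueSeq χ W m) x :=
      (hj.sub ((contDiff_glueSeq hχ hW m').sub (hP k))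
        ((contDiff_glueSeq hχ hW m).sub (hP k)) j1).congr
        (Eventually.of_forall fun z => by simp)
    have e1 : (1 + 8 * C) * b + b = (2 + 8 * C) * b := by ring
    rw [e1] at j2
    exact j2.scale_mono (hd0 m) (hanti (Nat.zero_le m)) hb'
  · refine JetLE.zero_of_eventuallyEq (hd0 0) hb' ?_
    filter_upwards [eventually_notMem_cthickening (hd0 m) hx] with z hz
    simp [glueSeq_eq_of_notMem (W := W) hanti h0 hm' hz]

/-- A Whitney type extension: approximants of a family of second order jets at decreasing scales
can be glued to a single `C²` function with these jets. -/
lemma exists_contDiff_of_jets (E : Type*) [NormedAddCommGroup E] [InnerProductSpace ℝ E]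
    [FiniteDimensional ℝ E] :
    ∃ C > 0, ∀ (K : Set E) (d : ℕ → ℝ) (P : E → E → ℝ) (W : ℕ → E → ℝ) (b₀ : ℝ),
      (∀ m, 0 < d m) → (∀ m, d (m + 1) = d m / 2) → (∀ k, ContDiff ℝ 2 (P k)) →
      (∀ m, ContDiff ℝ 2 (W m)) → 0 < b₀ →
      (∀ m, ∀ k ∈ K, ∀ x, dist x k < d m →
        JetLE b₀ (d m) (W m - P k) x ∧ JetLE b₀ (d m) (W (m + 1) - P k) x) →
      (∀ b > 0, ∃ N, ∀ m ≥ N, ∀ k ∈ K, ∀ x, dist x k < d m →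
        JetLE b (d m) (W m - P k) x ∧ JetLE b (d m) (W (m + 1) - P k) x) →
      ∃ v : E → ℝ, ContDiff ℝ 2 v ∧ (∀ k ∈ K, v k = P k k) ∧
        (∀ x ∉ cthickening (3 / 4 * d 0) K, v x = W 0 x) ∧
        ∀ x ∈ thickening (d 0) K, ∃ k ∈ K, dist x k < d 0 ∧ JetLE (C * b₀) (d 0) (v - P k) x := by
  obtain ⟨C, hC0, hC⟩ := exists_cutoff E
  refine ⟨2 + 8 * C, by positivity, fun K d P W b₀ hd0 hd hP hW hb₀ H0 H => ?_⟩
  choose χ hχ h1 h0 hχC using fun m => hC K (d m) (hd0 m)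
  have hanti : Antitone d := antitone_nat_of_succ_le fun m => by
    rw [hd]
    linarith [hd0 m]
  have hvC : ∀ m, ContDiff ℝ 2 (glueSeq χ W m) := contDiff_glueSeq hχ hW
  choose N hN using fun j : ℕ => H (1 / 2 ^ j) (by positivity)
  set n : ℕ → ℕ := fun j => ∑ i ∈ Finset.range (j + 1), N i with hn
  have hNn : ∀ j, N j ≤ n j := fun j =>
    Finset.single_le_sum (f := N) (fun _ _ => Nat.zero_le _) (Finset.self_mem_range_succ j)
  have hnn : ∀ j, n j ≤ n (j + 1) := fun j => by
    simp only [hn]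
    rw [Finset.sum_range_succ _ (j + 1)]
    exact Nat.le_add_right _ _
  obtain ⟨v, hv, hvj⟩ := exists_contDiff_limit (b := 2 + 8 * C) (d := d 0)
    (v := fun j => glueSeq χ W (n j)) (fun j => hvC _) fun j x => by
      have := JetLE.glueSeq_sub hχ hW hd0 hd hC0 h1 h0 hχC hP (b := 1 / 2 ^ j) (by positivity)
        (hN j) (hNn j) (hnn j) x
      rwa [mul_one_div] at this
  have hto : ∀ c : ℝ, Tendsto (fun j : ℕ => c / 2 ^ j) atTop (𝓝 0) := fun c => by
    have := (tendsto_pow_atTop_nhds_zero_of_lt_one (r := (1 / 2 : ℝ)) (by norm_num)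
      (by norm_num)).const_mul c
    rw [mul_zero] at this
    refine this.congr fun j => ?_
    rw [one_div, inv_pow, div_eq_mul_inv]
  have hlim : ∀ x, Tendsto (fun j => glueSeq χ W (n j) x) atTop (𝓝 (v x)) := fun x => by
    have h2 : Tendsto (fun j : ℕ => 2 * (2 + 8 * C) / 2 ^ j * d 0 ^ 2) atTop (𝓝 0) := by
      simpa using (hto (2 * (2 + 8 * C))).mul_const (d 0 ^ 2)
    rw [tendsto_iff_dist_tendsto_zero]
    refine squeeze_zero (fun _ => dist_nonneg) (fun j => ?_) h2
    rw [dist_comm, Real.dist_eq]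
    exact (hvj j x).abs_le
  refine ⟨v, hv, fun k hk => ?_, fun x hx => ?_, fun x hx => ?_⟩
  · refine tendsto_nhds_unique (hlim k) ?_
    have h2 : Tendsto (fun j : ℕ => 1 / 2 ^ j * d 0 ^ 2) atTop (𝓝 0) := by
      simpa only [zero_mul] using (hto 1).mul_const (d 0 ^ 2)
    rw [tendsto_iff_dist_tendsto_zero]
    refine squeeze_zero (fun _ => dist_nonneg) (fun j => ?_) h2
    have hkm : k ∈ thickening (d (n j)) K := self_subset_thickening (hd0 _) K hk
    have h3 := (hN j (n j) (hNn j) k hk k (by simpa using hd0 _)).1.scale_mono (hd0 _)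
      (hanti (Nat.zero_le _)) (by positivity)
    rw [Real.dist_eq, (glueSeq_eventuallyEq (W := W) hd h1 (n j) hkm).self_of_nhds]
    exact h3.abs_le
  · refine tendsto_nhds_unique (hlim x) (tendsto_const_nhds.congr fun j => ?_)
    exact (glueSeq_eq_of_notMem (W := W) hanti h0 (Nat.zero_le _) hx).symm
  · obtain ⟨j, hj⟩ := ((hto (2 * (2 + 8 * C))).eventually (gt_mem_nhds hb₀)).exists
    obtain ⟨k, hk, hxk, hJ⟩ := JetLE.glueSeq hχ hW hd0 hd hC0 h1 h0 hχC hP hb₀.le (N := 0)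
      (fun m _ => H0 m) le_rfl (Nat.zero_le (n j)) hx
    refine ⟨k, hk, hxk, ?_⟩
    have j1 : JetLE (b₀ + (1 + 8 * C) * b₀) (d 0) (v - P k) x :=
      (((hvj j x).mono (hd0 0).le hj.le).add (hv.sub (hvC _)) ((hvC _).sub (hP k)) hJ).congr
        (Eventually.of_forall fun z => by simp)
    exact j1.mono (hd0 0).le (by linarith)

end GlueSequence

section LocalExtension

open scoped RealInnerProductSpace Topology NNReal

variable {E : Type*} [NormedAddCommGroup E] [InnerProductSpace ℝ E]

lemma le_second_difference {u : E → ℝ} {η : ℝ}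
    (hu : ConvexOn ℝ univ fun x => u x - η / 2 * ‖x‖ ^ 2) (x h : E) :
    η * ‖h‖ ^ 2 ≤ u (x + h) + u (x - h) - 2 * u x := by
  have h1 := hu.2 (mem_univ (x + h)) (mem_univ (x - h))
    (by norm_num : (0 : ℝ) ≤ 1 / 2) (by norm_num : (0 : ℝ) ≤ 1 / 2) (by norm_num)
  have h2 : (1 / 2 : ℝ) • (x + h) + (1 / 2 : ℝ) • (x - h) = x := by
    rw [← smul_add, add_add_sub_cancel, ← two_smul ℝ x, smul_smul]
    norm_num
  rw [h2] at h1
  simp only [smul_eq_mul] at h1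
  have h3 := parallelogram_law_with_norm ℝ x h
  have h4 := congrArg (η / 2 * ·) h3
  linarith

lemma quadratic_add (u : E → ℝ) (k p : E) (A : E →L[ℝ] E) (h : E) :
    u (k + h) - quadratic (u k) k p A (k + h) = taylorRemainder u k p A h := by
  simp only [quadratic, taylorRemainder, add_sub_cancel_left]
  ring

lemma abs_sub_quadratic_le {u : E → ℝ} {k p : E} {A : E →L[ℝ] E} {ω δ r : ℝ} (hω : 0 ≤ ω)
    (h : ∀ h, ‖h‖ ≤ δ → |taylorRemainder u k p A h| ≤ ω * ‖h‖ ^ 2) {z : E}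
    (hz : dist z k ≤ r) (hr : r ≤ δ) : |u z - quadratic (u k) k p A z| ≤ ω * r ^ 2 := by
  have h1 := h (z - k) (by rw [← dist_eq_norm]; exact hz.trans hr)
  rw [← quadratic_add, add_sub_cancel, ← dist_eq_norm] at h1
  refine h1.trans ?_
  have : (0 : ℝ) ≤ dist z k := dist_nonneg
  gcongr

lemma le_inner_of_taylorRemainder_le {u : E → ℝ} {η : ℝ}
    (hu : ConvexOn ℝ univ fun x => u x - η / 2 * ‖x‖ ^ 2) {k p : E} {A : E →L[ℝ] E}
    (h : ∀ ω > 0, ∃ δ > 0, ∀ h, ‖h‖ ≤ δ → |taylorRemainder u k p A h| ≤ ω * ‖h‖ ^ 2) (e : E) :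
    η * ‖e‖ ^ 2 ≤ ⟪A e, e⟫ := by
  rcases eq_or_ne e 0 with rfl | he
  · simp
  have he0 : 0 < ‖e‖ := norm_pos_iff.2 he
  refine le_of_forall_pos_le_add fun ε hε => ?_
  obtain ⟨δ, hδ, H⟩ := h (ε / (2 * ‖e‖ ^ 2)) (by positivity)
  set t := δ / ‖e‖ with ht
  have ht0 : 0 < t := by positivity
  have hn : ‖t • e‖ = t * ‖e‖ := by rw [norm_smul, Real.norm_of_nonneg ht0.le]
  have hn' : t * ‖e‖ = δ := by rw [ht]; field_simp
  have h1 := (abs_le.1 (H (t • e) (by rw [hn, hn']))).2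
  have h2 := (abs_le.1 (H (-(t • e)) (by rw [norm_neg, hn, hn']))).2
  have h3 := le_second_difference hu k (t • e)
  simp only [taylorRemainder, norm_neg, hn, map_neg, inner_neg_right, inner_neg_left, map_smul,
    inner_smul_left, inner_smul_right, RCLike.conj_to_real, ← sub_eq_add_neg] at h1 h2 h3
  have h4 : ε / (2 * ‖e‖ ^ 2) * (t * ‖e‖) ^ 2 = ε / 2 * t ^ 2 := by field_simp
  rw [h4] at h1 h2
  have h5 : t ^ 2 * (η * ‖e‖ ^ 2) ≤ t ^ 2 * (⟪A e, e⟫ + ε) := by nlinarith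
  exact le_of_mul_le_mul_left h5 (by positivity)

lemma JetLE.const_mul {b d : ℝ} {f : E → ℝ} {x : E} (hf : ContDiff ℝ 2 f) (c : ℝ)
    (h : JetLE b d f x) : JetLE (|c| * b) d (fun y => c * f y) x := by
  intro i hi
  have h1 : iteratedFDeriv ℝ i (fun y => c * f y) x = c • iteratedFDeriv ℝ i f x :=
    iteratedFDeriv_const_smul_apply (a := c) (f := f)
      (hf.of_le (by exact_mod_cast hi)).contDiffAt
  rw [h1, norm_smul, Real.norm_eq_abs, mul_assoc, mul_div_assoc]
  exact mul_le_mul_of_nonneg_left (h i hi) (abs_nonneg c)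

lemma JetLE.const {b d c : ℝ} (hd : 0 < d) (hb : 0 ≤ b) (hc : |c| ≤ b * d ^ 2) (x : E) :
    JetLE b d (fun _ => c) x := by
  intro i hi
  rcases Nat.eq_zero_or_pos i with rfl | hi0
  · simpa using hc
  · rw [iteratedFDeriv_const_of_ne hi0.ne']
    simp only [Pi.zero_apply, norm_zero]
    positivity

variable [FiniteDimensional ℝ E] [MeasurableSpace E] [BorelSpace E]

/-- Combination of two mollifications which reproduces quadratic polynomials. -/
noncomputable def richardson (d : ℝ) (f : E → ℝ) (x : E) : ℝ :=
  4 / 3 * mollify d f x + -(1 / 3) * mollify (2 * d) f x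

lemma contDiff_richardson {f : E → ℝ} (hf : Continuous f) {d : ℝ} (hd : 0 < d) :
    ContDiff ℝ 2 (richardson d f) :=
  (contDiff_const.mul (contDiff_mollify (n := 2) hf hd)).add
    (contDiff_const.mul (contDiff_mollify (n := 2) hf (by positivity)))

lemma exists_jetLE_mollify (E : Type*) [NormedAddCommGroup E]
    [InnerProductSpace ℝ E] [FiniteDimensional ℝ E] [MeasurableSpace E] [BorelSpace E] :
    ∃ C > 0, ∀ f : E → ℝ, Continuous f → ∀ ρ > 0, ∀ x b, (∀ z ∈ closedBall x ρ, |f z| ≤ b * ρ ^ 2) →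
      JetLE (C * b) ρ (mollify ρ f) x := by
  obtain ⟨C, hC0, hC⟩ := exists_norm_iteratedFDeriv_mollify_le E
  refine ⟨C, hC0, fun f hf ρ hρ x b h i hi => ?_⟩
  have := hC i hi f hf ρ hρ x _ h
  rwa [← mul_assoc] at this

lemma exists_jetLE_sub_quadratic (E : Type*) [NormedAddCommGroup E]
    [InnerProductSpace ℝ E] [FiniteDimensional ℝ E] [MeasurableSpace E] [BorelSpace E] :
    ∃ C > 0, ∀ u : E → ℝ, Continuous u → ∀ (k p : E) (A : E →L[ℝ] E) (ω δ : ℝ), 0 ≤ ω →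
      (∀ h, ‖h‖ ≤ δ → |taylorRemainder u k p A h| ≤ ω * ‖h‖ ^ 2) → ∀ d > 0, 3 * d ≤ δ →
      ∀ x, dist x k < d →
      JetLE (C * ω) d (richardson d u - quadratic (u k) k p A) x ∧
      ∀ M, 0 ≤ M → (∀ h, |⟪A h, h⟫| ≤ M * ‖h‖ ^ 2) → ∀ κ, 0 < κ → κ ≤ 1 →
        JetLE (C * ω / κ ^ 2 + κ ^ 2 * M) d (mollify (κ * d) u - quadratic (u k) k p A) x := by
  obtain ⟨C, hC0, hC⟩ := exists_jetLE_mollify E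
  refine ⟨15 * C, by positivity, fun u hu k p A ω δ hω hT d hd hdδ x hx => ?_⟩
  set P := quadratic (u k) k p A with hP
  have hPc : Continuous P := (contDiff_quadratic (n := 2) (u k) k p A).continuous
  have hg : Continuous fun z => u z - P z := hu.sub hPc
  have hd2 : 0 < 2 * d := by positivity
  refine ⟨?_, fun M hM hA κ hκ hκ1 => ?_⟩
  · have j1 := (hC _ hg d hd x (4 * ω) fun z hz => by
      have := abs_sub_quadratic_le hω hT (r := 2 * d) (z := z)
        (by linarith [mem_closedBall.1 hz, dist_triangle z x k]) (by linarith)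
      linarith).const_mul (contDiff_mollify (n := 2) hg hd) (4 / 3)
    have j2 := ((hC _ hg (2 * d) hd2 x (9 / 4 * ω) fun z hz => by
      have := abs_sub_quadratic_le hω hT (r := 3 * d) (z := z)
        (by linarith [mem_closedBall.1 hz, dist_triangle z x k]) (by linarith)
      linarith).const_mul (contDiff_mollify (n := 2) hg hd2) (-(1 / 3))).double_scale hd
      (by positivity)
    refine ((j1.add (contDiff_const.mul (contDiff_mollify (n := 2) hg hd))
      (contDiff_const.mul (contDiff_mollify (n := 2) hg hd2)) j2).congr
      (Eventually.of_forall fun z => ?_)).mono hd.le ?_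
    · simp only [Pi.add_apply, Pi.sub_apply, mollify_sub hu hPc, richardson]
      rw [hP, mollify_quadratic, mollify_quadratic]
      ring
    · rw [abs_of_pos (by norm_num : (0 : ℝ) < 4 / 3), abs_neg,
        abs_of_pos (by norm_num : (0 : ℝ) < 1 / 3)]
      nlinarith [mul_nonneg hC0.le hω]
  · have hκd : 0 < κ * d := by positivity
    have hκd' : κ * d ≤ d := by nlinarith
    have j1 := (hC _ hg (κ * d) hκd x (4 * ω / κ ^ 2) fun z hz => by
      have := abs_sub_quadratic_le hω hT (r := 2 * d) (z := z)
        (by linarith [mem_closedBall.1 hz, dist_triangle z x k]) (by linarith)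
      have e : 4 * ω / κ ^ 2 * (κ * d) ^ 2 = ω * (2 * d) ^ 2 := by field_simp; ring
      rwa [e]).scale_mono hκd hκd' (by positivity)
    have hI := abs_integral_mollifier_mul_inner_le hA
    rw [abs_of_nonneg hM] at hI
    have j2 : JetLE (κ ^ 2 * M) d
        (fun _ : E => (κ * d) ^ 2 * (1 / 2 * ∫ y, mollifier E y * ⟪A y, y⟫)) x := by
      refine JetLE.const hd (by positivity) ?_ x
      rw [abs_mul, abs_of_nonneg (by positivity), abs_mul, abs_of_pos (by norm_num : (0:ℝ) < 1 / 2)]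
      have : (κ * d) ^ 2 * (1 / 2 * |∫ y, mollifier E y * ⟪A y, y⟫|) ≤ (κ * d) ^ 2 * M := by
        gcongr
        linarith
      linarith
    refine ((j1.add (contDiff_mollify (n := 2) hg hκd) contDiff_const j2).congr
      (Eventually.of_forall fun z => ?_)).mono hd.le ?_
    · simp only [Pi.add_apply, Pi.sub_apply, mollify_sub hu hPc]
      rw [hP, mollify_quadratic]
      ring
    · have : C * (4 * ω / κ ^ 2) ≤ 15 * C * ω / κ ^ 2 := by
        rw [← mul_div_assoc]
        gcongr ?_ / _
        nlinarith [mul_nonneg hC0.le hω]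
      linarith

/-- Near a set where `u` has uniform second order Taylor expansions, a mollification of `u` can be
modified so as to agree with `u` on this set while keeping the lower bound on the Hessian. -/
lemma exists_local_extension {u : E → ℝ} (hu : Continuous u) {η η' : ℝ} (hη : η' < η)
    (hconv : ConvexOn ℝ univ fun x => u x - η / 2 * ‖x‖ ^ 2) {K : Set E} {M : ℝ} (hM : 0 ≤ M)
    {p : E → E} {A : E → E →L[ℝ] E} (hA : ∀ k ∈ K, ∀ h, |⟪A k h, h⟫| ≤ M * ‖h‖ ^ 2)
    (hT : ∀ ω > 0, ∃ δ > 0, ∀ k ∈ K, ∀ h, ‖h‖ ≤ δ →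
      |taylorRemainder u k (p k) (A k) h| ≤ ω * ‖h‖ ^ 2) {δ ε : ℝ} (hδ : 0 < δ) (hε : 0 < ε) :
    ∃ ρ d, 0 < ρ ∧ ρ < δ ∧ 0 < d ∧ d < δ ∧ ∃ v : E → ℝ, ContDiff ℝ 2 v ∧ (∀ k ∈ K, v k = u k) ∧
      (∀ x ∉ thickening d K, v =ᶠ[𝓝 x] mollify ρ u) ∧
      ∀ x ∈ thickening d K, (∀ e, η' * ‖e‖ ^ 2 ≤ hessianForm v x e) ∧ |v x - u x| ≤ ε := by
  obtain ⟨C, hC0, hC⟩ := exists_jetLE_sub_quadratic E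
  obtain ⟨C', hC'0, hC'⟩ := exists_contDiff_of_jets E
  set b₀ := (η - η') / C' with hb₀
  have hηη : 0 < η - η' := sub_pos.2 hη
  have hb₀0 : 0 < b₀ := by positivity
  obtain ⟨κ, hκ0, hκ1, hκM⟩ : ∃ κ : ℝ, 0 < κ ∧ κ ≤ 1 ∧ κ ^ 2 * M ≤ b₀ / 2 := by
    refine ⟨min 1 (b₀ / (2 * (M + 1))), by positivity, min_le_left _ _, ?_⟩
    set κ := min 1 (b₀ / (2 * (M + 1)))
    have h0 : 0 < κ := by positivity
    have h1 : κ ≤ 1 := min_le_left _ _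
    have h2 : κ ≤ b₀ / (2 * (M + 1)) := min_le_right _ _
    rw [le_div_iff₀ (by positivity)] at h2
    have h3 : κ ^ 2 ≤ κ := by nlinarith
    nlinarith [mul_le_mul_of_nonneg_right h3 hM]
  set ω := b₀ * κ ^ 2 / (4 * C) with hω
  have hω0 : 0 < ω := by positivity
  have hωκ : C * ω / κ ^ 2 = b₀ / 4 := by rw [hω]; field_simp
  have hωb : 4 * (C * ω) ≤ b₀ := by
    have : 4 * (C * ω) = b₀ * κ ^ 2 := by rw [hω]; field_simp
    nlinarith [mul_le_mul_of_nonneg_left (pow_le_one₀ hκ0.le hκ1 : κ ^ 2 ≤ 1) hb₀0.le]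
  obtain ⟨δω, hδω, hTω⟩ := hT ω hω0
  obtain ⟨D, hD0, hDδ, hD3, hD1, hDε⟩ : ∃ D : ℝ, 0 < D ∧ D < δ ∧ 3 * D ≤ δω ∧ D ≤ 1 ∧
      (η - η' + ω) * D ≤ ε := by
    refine ⟨min (min (δ / 2) (δω / 3)) (min 1 (ε / (η - η' + ω))), by positivity, ?_, ?_, ?_, ?_⟩
    · exact ((min_le_left _ _).trans (min_le_left _ _)).trans_lt (by linarith)
    · have := (min_le_left (min (δ / 2) (δω / 3)) (min 1 (ε / (η - η' + ω)))).trans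
        (min_le_right _ _)
      linarith
    · exact (min_le_right _ _).trans (min_le_left _ _)
    · have := (min_le_right (min (δ / 2) (δω / 3)) (min 1 (ε / (η - η' + ω)))).trans
        (min_le_right _ _)
      rwa [le_div_iff₀' (by positivity)] at this
  set d : ℕ → ℝ := fun m => D / 2 ^ m with hd
  have hd0 : ∀ m, 0 < d m := fun m => by positivity
  have hds : ∀ m, d (m + 1) = d m / 2 := fun m => by
    simp only [hd, pow_succ]
    rw [div_mul_eq_div_div]
  have hdD : ∀ m, d m ≤ D := fun m => div_le_self hD0.le (one_le_pow₀ (by norm_num))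
  have hd00 : d 0 = D := by simp [hd]
  set P : E → E → ℝ := fun k => quadratic (u k) k (p k) (A k) with hP
  set W : ℕ → E → ℝ := fun m => Nat.casesOn m (mollify (κ * D) u) fun m => richardson (d m) u
    with hW
  have hκD : 0 < κ * D := by positivity
  have hWs : ∀ {ω δ' : ℝ}, 0 < ω → (∀ k ∈ K, ∀ h, ‖h‖ ≤ δ' →
      |taylorRemainder u k (p k) (A k) h| ≤ ω * ‖h‖ ^ 2) → ∀ m, 3 * d m ≤ δ' → ∀ k ∈ K, ∀ x,
      dist x k < d m → JetLE (C * ω) (d m) (W (m + 1) - P k) x := fun hω H m hm k hk x hx =>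
    (hC u hu k (p k) (A k) _ _ hω.le (H k hk) (d m) (hd0 m) hm x hx).1
  have hWs' : ∀ {ω δ' : ℝ}, 0 < ω → (∀ k ∈ K, ∀ h, ‖h‖ ≤ δ' →
      |taylorRemainder u k (p k) (A k) h| ≤ ω * ‖h‖ ^ 2) → ∀ m, 3 * d m ≤ δ' → ∀ k ∈ K, ∀ x,
      dist x k < d (m + 1) → JetLE (4 * (C * ω)) (d (m + 1)) (W (m + 1) - P k) x :=
    fun {ω δ'} hω H m hm k hk x hx => by
      have e : d m = 2 * d (m + 1) := by rw [hds]; ring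
      have h := hWs hω H m hm k hk x (by linarith [hd0 (m + 1)])
      rw [e] at h
      exact h.double_scale (hd0 _) (by positivity)
  have hWC : ∀ m, ContDiff ℝ 2 (W m) := fun m => by
    cases m with
    | zero => exact contDiff_mollify (n := 2) hu hκD
    | succ m => exact contDiff_richardson hu (hd0 m)
  have H0 : ∀ m, ∀ k ∈ K, ∀ x, dist x k < d m →
      JetLE b₀ (d m) (W m - P k) x ∧ JetLE b₀ (d m) (W (m + 1) - P k) x := by
    intro m k hk x hx
    have h3 : ∀ m, 3 * d m ≤ δω := fun m => by linarith [hdD m]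
    refine ⟨?_, (hWs hω0 hTω m (h3 m) k hk x hx).mono (hd0 m).le (by linarith [mul_pos hC0 hω0])⟩
    cases m with
    | zero =>
      rw [hd00] at hx ⊢
      exact ((hC u hu k (p k) (A k) ω δω hω0.le (hTω k hk) D hD0 hD3 x hx).2 M hM (hA k hk) κ hκ0
        hκ1).mono hD0.le (by linarith)
    | succ m => exact (hWs' hω0 hTω m (h3 m) k hk x hx).mono (hd0 _).le hωb
  have H1 : ∀ b > 0, ∃ N, ∀ m ≥ N, ∀ k ∈ K, ∀ x, dist x k < d m →
      JetLE b (d m) (W m - P k) x ∧ JetLE b (d m) (W (m + 1) - P k) x := by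
    intro b hb
    obtain ⟨δ', hδ', hT'⟩ := hT (b / (4 * C)) (by positivity)
    have hlim : Tendsto (fun m => 3 * d m) atTop (𝓝 0) := by
      have := ((tendsto_pow_atTop_nhds_zero_of_lt_one (r := (1 / 2 : ℝ)) (by norm_num)
        (by norm_num)).const_mul D).const_mul 3
      rw [mul_zero, mul_zero] at this
      refine this.congr fun j => ?_
      simp only [hd]
      rw [one_div, inv_pow, div_eq_mul_inv]
    obtain ⟨N, hN⟩ := eventually_atTop.1 (hlim.eventually (gt_mem_nhds hδ'))
    have hCb : 4 * (C * (b / (4 * C))) = b := by field_simp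
    have hCb0 : 0 < C * (b / (4 * C)) := by positivity
    refine ⟨N + 1, fun m hm k hk x hx => ?_⟩
    obtain ⟨m, rfl⟩ : ∃ m', m = m' + 1 := ⟨m - 1, by omega⟩
    refine ⟨?_, ?_⟩
    · have := hWs' (by positivity) hT' m (hN m (by omega)).le k hk x hx
      rwa [hCb] at this
    · exact (hWs (by positivity) hT' (m + 1) (hN _ (by omega)).le k hk x hx).mono (hd0 _).le
        (by linarith)
  obtain ⟨v, hv, hvK, hvW, hvJ⟩ := hC' K d P W b₀ hd0 hds (fun k => contDiff_quadratic _ _ _ _)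
    hWC hb₀0 H0 H1
  rw [hd00] at hvW hvJ
  refine ⟨κ * D, D, hκD, by nlinarith, hD0, hDδ, v, hv, fun k hk => ?_, fun x hx => ?_,
    fun x hx => ?_⟩
  · rw [hvK k hk]
    simp [hP, quadratic]
  · filter_upwards [eventually_notMem_cthickening hD0 hx] with z hz using hvW z hz
  · obtain ⟨k, hk, hxk, hJ⟩ := hvJ x hx
    have hCb : C' * b₀ = η - η' := by rw [hb₀]; field_simp
    rw [hCb] at hJ
    refine ⟨fun e => ?_, ?_⟩
    · have h1 := hJ.abs_hessianForm_le hD0 e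
      rw [hessianForm_sub hv (contDiff_quadratic _ _ _ _), hessianForm_quadratic] at h1
      have h2 : η * ‖e‖ ^ 2 ≤ ⟪A k e, e⟫ := le_inner_of_taylorRemainder_le hconv
        (fun ω hω => (hT ω hω).imp fun δ h => ⟨h.1, h.2 k hk⟩) e
      linarith [(abs_le.1 h1).1]
    · have h1 := hJ.abs_le
      have h2 := abs_sub_quadratic_le hω0.le (hTω k hk) hxk.le (by linarith)
      rw [abs_sub_comm] at h2
      have h3 : D ^ 2 ≤ D := by nlinarith
      calc |v x - u x| ≤ |v x - P k x| + |P k x - u x| := abs_sub_le _ _ _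
        _ ≤ (η - η') * D ^ 2 + ω * D ^ 2 := add_le_add h1 h2
        _ = (η - η' + ω) * D ^ 2 := by ring
        _ ≤ (η - η' + ω) * D := by gcongr
        _ ≤ ε := hDε

end LocalExtension

section VariableRadius

open scoped RealInnerProductSpace Topology NNReal

variable {E : Type*} [NormedAddCommGroup E] [InnerProductSpace ℝ E] [FiniteDimensional ℝ E]
  [MeasurableSpace E] [BorelSpace E]

lemma norm_sq_le_mollify_norm_sq (σ : ℝ) (x : E) :
    ‖x‖ ^ 2 ≤ mollify σ (fun z : E => ‖z‖ ^ 2) x := by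
  have hq : (fun z : E => ‖z‖ ^ 2) =
      quadratic 0 0 0 ((2 : ℝ) • ContinuousLinearMap.id ℝ E) := by
    funext z
    simp [quadratic, inner_smul_left]
  have h0 : 0 ≤ ∫ y : E, mollifier E y * ⟪((2 : ℝ) • ContinuousLinearMap.id ℝ E) y, y⟫ := by
    refine integral_nonneg fun y => mul_nonneg (mollifier_nonneg y) ?_
    simp [inner_smul_left]
  have h1 := mollify_quadratic σ 0 0 0 ((2 : ℝ) • ContinuousLinearMap.id ℝ E) x
  rw [← hq] at h1
  rw [h1]
  have : 0 ≤ σ ^ 2 * (1 / 2 * ∫ y : E, mollifier E y *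
      ⟪((2 : ℝ) • ContinuousLinearMap.id ℝ E) y, y⟫) := by positivity
  linarith

lemma le_mollify_second_difference {u : E → ℝ} (hu : Continuous u) {η : ℝ} (hη : 0 ≤ η)
    (hconv : ConvexOn ℝ univ fun x => u x - η / 2 * ‖x‖ ^ 2) (x h : E) (s s' : ℝ) :
    η * ‖h‖ ^ 2 ≤ mollify s u (x + h) + mollify s' u (x - h) -
      2 * mollify ((s + s') / 2) u x := by
  refine (mul_le_mul_of_nonneg_left (norm_sq_le_mollify_norm_sq ((s - s') / 2) h) hη).trans ?_
  have i1 := integrable_mollify hu s (x + h)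
  have i2 := integrable_mollify hu s' (x - h)
  have i12 : Integrable fun y : E => mollifier E y * u (x + h - s • y) +
    mollifier E y * u (x - h - s' • y) := i1.add i2
  have i3 := (integrable_mollify hu ((s + s') / 2) x).const_mul 2
  have hn : Continuous fun z : E => ‖z‖ ^ 2 := by fun_prop
  have i4 := (integrable_mollify hn ((s - s') / 2) h).const_mul η
  simp only [mollify]
  rw [← integral_const_mul, ← integral_const_mul, ← integral_add i1 i2,
    ← integral_sub i12 i3]
  refine integral_mono i4 (i12.sub i3) fun y => ?_
  have h1 := le_second_difference hconv (x - ((s + s') / 2) • y) (h - ((s - s') / 2) • y)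
  have e1 : x - ((s + s') / 2) • y + (h - ((s - s') / 2) • y) = x + h - s • y := by module
  have e2 : x - ((s + s') / 2) • y - (h - ((s - s') / 2) • y) = x - h - s' • y := by module
  rw [e1, e2] at h1
  have := mul_le_mul_of_nonneg_left h1 (mollifier_nonneg y)
  dsimp only
  linarith

lemma abs_mollify_sub_mollify_le {u : E → ℝ} (hu : Continuous u) {L : ℝ≥0} {S : Set E}
    (hL : LipschitzOnWith L u S) {x : E} {s s' : ℝ} (hs : closedBall x |s| ⊆ S)
    (hs' : closedBall x |s'| ⊆ S) : |mollify s u x - mollify s' u x| ≤ L * |s - s'| := by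
  have i1 := integrable_mollify hu s x
  have i2 := integrable_mollify hu s' x
  simp only [mollify]
  rw [← integral_sub i1 i2, ← Real.norm_eq_abs]
  have i3 : Integrable fun y : E => mollifier E y * (L * |s - s'|) :=
    integrable_mollifier_mul continuous_const
  refine (norm_integral_le_of_norm_le i3 (Eventually.of_forall fun y => ?_)).trans ?_
  · rw [← mul_sub, norm_mul, Real.norm_of_nonneg (mollifier_nonneg y)]
    rcases le_or_gt 1 ‖y‖ with hy | hy
    · simp [mollifier_eq_zero hy]
    refine mul_le_mul_of_nonneg_left ?_ (mollifier_nonneg y)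
    have hmem : ∀ r : ℝ, x - r • y ∈ closedBall x |r| := fun r => by
      rw [mem_closedBall, dist_eq_norm, sub_sub_cancel_left, norm_neg, norm_smul,
        Real.norm_eq_abs]
      exact mul_le_of_le_one_right (abs_nonneg r) hy.le
    refine (hL.norm_sub_le (hs (hmem s)) (hs' (hmem s'))).trans ?_
    have : x - s • y - (x - s' • y) = (s' - s) • y := by module
    rw [this, norm_smul, Real.norm_eq_abs, abs_sub_comm]
    gcongr
    exact mul_le_of_le_one_right (abs_nonneg _) hy.le
  · rw [integral_mul_const, integral_mollifier, one_mul]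

lemma mollify_zero (u : E → ℝ) (x : E) : mollify 0 u x = u x := by
  simp [mollify, integral_mul_const, integral_mollifier]

/-- Mollification with a slowly varying small radius nearly preserves strong convexity. -/
lemma exists_forall_mollify_variable {u : E → ℝ} (hu : LocallyLipschitz u) {η η' : ℝ} (hη : 0 ≤ η)
    (hη' : η' < η) (hconv : ConvexOn ℝ univ fun x => u x - η / 2 * ‖x‖ ^ 2) {θ : E → ℝ}
    (hθ : ContDiff ℝ 2 θ) (hθI : ∀ x, θ x ∈ Icc (0 : ℝ) 1) (R : ℝ) {ε : ℝ} (hε : 0 < ε) :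
    ∃ r > 0, ∀ ρ ρ', 0 < ρ → ρ < r → 0 < ρ' → ρ' < r →
      ContDiff ℝ 2 (fun x => mollify (ρ + (ρ' - ρ) * θ x) u x) ∧ ∀ x ∈ ball (0 : E) R,
      (∀ e, η' * ‖e‖ ^ 2 ≤ hessianForm (fun x => mollify (ρ + (ρ' - ρ) * θ x) u x) x e) ∧
      |mollify (ρ + (ρ' - ρ) * θ x) u x - u x| ≤ ε := by
  have huc := hu.continuous
  obtain ⟨L, hL⟩ := (hu.locallyLipschitzOn
    (s := closedBall (0 : E) (R + 1))).exists_lipschitzOnWith_of_compact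
    (isCompact_closedBall (0 : E) (R + 1))
  obtain ⟨B, hB⟩ := (isCompact_closedBall (0 : E) R).exists_bound_of_continuousOn
    (hθ.continuous_iteratedFDeriv (m := 2) le_rfl).continuousOn
  have hηη : 0 < η - η' := sub_pos.2 hη'
  refine ⟨min 1 (min (ε / (L + 1)) ((η - η') / (L * |B| + 1))), by positivity,
    fun ρ ρ' hρ hρr hρ' hρ'r => ?_⟩
  set r := min 1 (min (ε / (L + 1)) ((η - η') / (L * |B| + 1))) with hr
  have hr0 : 0 < r := by positivity
  have hr1 : r ≤ 1 := min_le_left _ _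
  have hrε : L * r ≤ ε := by
    have : r ≤ ε / (L + 1) := (min_le_right _ _).trans (min_le_left _ _)
    rw [le_div_iff₀ (by positivity)] at this
    linarith
  have hrη : L * r * |B| ≤ η - η' := by
    have : r ≤ (η - η') / (L * |B| + 1) := (min_le_right _ _).trans (min_le_right _ _)
    rw [le_div_iff₀ (by positivity)] at this
    linarith
  set s : E → ℝ := fun x => ρ + (ρ' - ρ) * θ x with hs
  have hs0 : ∀ x, 0 < s x := fun x => by
    obtain ⟨h0, h1⟩ := hθI x
    have : s x = (1 - θ x) * ρ + θ x * ρ' := by simp only [hs]; ring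
    rw [this]
    rcases h0.eq_or_lt with h | h
    · rw [← h]; linarith
    · nlinarith [mul_nonneg (sub_nonneg.2 h1) hρ.le, mul_pos h hρ']
  have hsr : ∀ x, s x ≤ r := fun x => by
    obtain ⟨h0, h1⟩ := hθI x
    have : s x = (1 - θ x) * ρ + θ x * ρ' := by simp only [hs]; ring
    rw [this]
    nlinarith [mul_le_mul_of_nonneg_left hρr.le (sub_nonneg.2 h1),
      mul_le_mul_of_nonneg_left hρ'r.le h0]
  have hF : ContDiff ℝ 2 fun x => mollify (s x) u x :=
    contDiff_mollify_param (n := 2) huc (contDiff_const.add (contDiff_const.mul hθ)) hs0 hsr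
  have hsub : ∀ x ∈ ball (0 : E) R, ∀ σ : ℝ, 0 ≤ σ → σ ≤ r →
      closedBall x |σ| ⊆ closedBall 0 (R + 1) := fun x hx σ h0 h1 => by
    refine closedBall_subset_closedBall' ?_
    rw [abs_of_nonneg h0]
    linarith [mem_ball.1 hx]
  refine ⟨hF, fun x hx => ⟨fun e => ?_, ?_⟩⟩
  · refine le_of_forall_pos_le_add fun γ hγ => ?_
    have hgoal : η * ‖e‖ ^ 2 - L * r * (|hessianForm θ x e| + γ / (L * r + 1)) ≤
        hessianForm (fun x => mollify (s x) u x) x e := by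
      refine le_hessianForm hF ?_
      have ht := (tendsto_second_difference hθ x e).eventually
        (isOpen_lt continuous_abs continuous_const |>.mem_nhds
          (show |hessianForm θ x e| < |hessianForm θ x e| + γ / (L * r + 1) by
            have : 0 < γ / (L * r + 1) := by positivity
            linarith))
      filter_upwards [ht, self_mem_nhdsWithin] with t ht ht0
      have ht0 : 0 < t := ht0
      have h1 := le_mollify_second_difference huc hη hconv x (t • e) (s (x + t • e))
        (s (x - t • e))
      have h2 := abs_mollify_sub_mollify_le huc hL (x := x)
        (s := (s (x + t • e) + s (x - t • e)) / 2) (s' := s x)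
        (hsub x hx _ (by linarith [hs0 (x + t • e), hs0 (x - t • e)])
          (by linarith [hsr (x + t • e), hsr (x - t • e)])) (hsub x hx _ (hs0 x).le (hsr x))
      have h3 : |(s (x + t • e) + s (x - t • e)) / 2 - s x| ≤
          r / 2 * (t ^ 2 * (|hessianForm θ x e| + γ / (L * r + 1))) := by
        have e1 : (s (x + t • e) + s (x - t • e)) / 2 - s x =
            (ρ' - ρ) / 2 * (θ (x + t • e) + θ (x - t • e) - 2 * θ x) := by
          simp only [hs]
          ring
        rw [e1, abs_mul]
        have h4 : |(ρ' - ρ) / 2| ≤ r / 2 := by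
          rw [abs_le]
          constructor <;> linarith
        have h5 : |θ (x + t • e) + θ (x - t • e) - 2 * θ x| ≤
            t ^ 2 * (|hessianForm θ x e| + γ / (L * r + 1)) := by
          have h6 := (show |_| < _ from ht).le
          rw [abs_div, abs_of_pos (by positivity : 0 < t ^ 2),
            div_le_iff₀ (by positivity)] at h6
          linarith
        exact mul_le_mul h4 h5 (abs_nonneg _) (by positivity)
      have h7 := (abs_le.1 h2).1
      have h8 := mul_le_mul_of_nonneg_left h3 L.coe_nonneg
      rw [norm_smul, Real.norm_of_nonneg ht0.le] at h1
      linarith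
    have h9 : |hessianForm θ x e| ≤ |B| * ‖e‖ ^ 2 := by
      refine (abs_hessianForm_le θ x e).trans ?_
      gcongr
      exact (hB x (ball_subset_closedBall hx)).trans (le_abs_self B)
    have h10 : L * r * (γ / (L * r + 1)) ≤ γ := by
      rw [← mul_div_assoc, div_le_iff₀ (by positivity)]
      linarith
    have h11 : L * r * |hessianForm θ x e| ≤ L * r * (|B| * ‖e‖ ^ 2) := by gcongr
    have h12 := mul_le_mul_of_nonneg_right hrη (sq_nonneg ‖e‖)
    linarith
  · have h := abs_mollify_sub_mollify_le huc hL (x := x) (s := s x) (s' := 0)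
      (hsub x hx _ (hs0 x).le (hsr x)) (hsub x hx 0 le_rfl hr0.le)
    rw [mollify_zero, sub_zero, abs_of_pos (hs0 x)] at h
    exact h.trans ((mul_le_mul_of_nonneg_left (hsr x) L.coe_nonneg).trans hrε)

end VariableRadius

section AnnularGlue

open scoped RealInnerProductSpace Topology NNReal

variable {E : Type*} [NormedAddCommGroup E]

/-- The annulus on which `‖x‖ ^ 2` is within `r` of `j`. -/
def shell (E : Type*) [NormedAddCommGroup E] (j : ℕ) (r : ℝ) : Set E := {x | |‖x‖ ^ 2 - j| < r}

lemma isOpen_shell (j : ℕ) (r : ℝ) : IsOpen (shell E j r) :=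
  isOpen_lt (by fun_prop) continuous_const

lemma floor_eq_of_mem_shell {j : ℕ} {r : ℝ} (hr : r ≤ 1 / 2) {x : E} (hx : x ∈ shell E j r) :
    ⌊‖x‖ ^ 2 + 1 / 2⌋₊ = j := by
  obtain ⟨h1, h2⟩ := abs_lt.1 (show |‖x‖ ^ 2 - j| < r from hx)
  rw [Nat.floor_eq_iff (by positivity)]
  constructor <;> linarith

open Classical in
/-- The function which equals `V j` on the annulus `shell E j (1 / 2 - τ j)` and `R j` between the
annuli `shell E j (1 / 2 - τ j)` and `shell E (j + 1) (1 / 2 - τ (j + 1))`. -/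
noncomputable def annularGlue (τ : ℕ → ℝ) (V R : ℕ → E → ℝ) (x : E) : ℝ :=
  if x ∈ shell E ⌊‖x‖ ^ 2 + 1 / 2⌋₊ (1 / 2 - τ ⌊‖x‖ ^ 2 + 1 / 2⌋₊) then V ⌊‖x‖ ^ 2 + 1 / 2⌋₊ x
  else R ⌊‖x‖ ^ 2⌋₊ x

variable {τ : ℕ → ℝ} {V R : ℕ → E → ℝ}

lemma annularGlue_of_mem (hτ : ∀ j, 0 < τ j) {j : ℕ} {x : E} (hx : x ∈ shell E j (1 / 2 - τ j)) :
    annularGlue τ V R x = V j x := by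
  have h := floor_eq_of_mem_shell (by linarith [hτ j]) hx
  subst h
  exact if_pos hx

lemma annularGlue_of_notMem {j n : ℕ} {x : E} (hj : ⌊‖x‖ ^ 2 + 1 / 2⌋₊ = j) (hn : ⌊‖x‖ ^ 2⌋₊ = n)
    (hx : x ∉ shell E j (1 / 2 - τ j)) : annularGlue τ V R x = R n x := by
  subst hj hn
  exact if_neg hx

lemma annularGlue_eventuallyEq (hτ : ∀ j, 0 < τ j) (hτ' : ∀ j, τ j ≤ 1 / 4)
    (h1 : ∀ j : ℕ, ∀ x : E, x ∉ shell E j (1 / 2 - τ j) → j ≤ ‖x‖ ^ 2 →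
      ‖x‖ ^ 2 < j + 1 / 2 - τ j / 2 → V j x = R j x)
    (h2 : ∀ j : ℕ, ∀ x : E, x ∉ shell E (j + 1) (1 / 2 - τ (j + 1)) → ‖x‖ ^ 2 < j + 1 →
      j + 1 / 2 + τ (j + 1) / 2 < ‖x‖ ^ 2 → V (j + 1) x = R j x) (x : E) :
    ∃ j : ℕ, ‖x‖ ^ 2 < j + 1 ∧
      (annularGlue τ V R =ᶠ[𝓝 x] V j ∨ annularGlue τ V R =ᶠ[𝓝 x] R j) := by
  have hV : ∀ j, ∀ x ∈ shell E j (1 / 2 - τ j / 2), annularGlue τ V R x = V j x := by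
    intro j x hx
    by_cases hx' : x ∈ shell E j (1 / 2 - τ j)
    · exact annularGlue_of_mem hτ hx'
    have hj := floor_eq_of_mem_shell (by linarith [hτ j]) hx
    obtain ⟨h3, h4⟩ := abs_lt.1 (show |‖x‖ ^ 2 - j| < _ from hx)
    rcases le_or_gt (j : ℝ) (‖x‖ ^ 2) with h | h
    · rw [h1 j x hx' h (by linarith)]
      refine annularGlue_of_notMem hj ?_ hx'
      rw [Nat.floor_eq_iff (by positivity)]
      exact ⟨h, by linarith [hτ j]⟩
    · cases j with
      | zero =>
        rw [Nat.cast_zero] at h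
        exact absurd h (not_lt.2 (by positivity))
      | succ n =>
        push_cast at h h3 h4
        rw [h2 n x hx' h (by linarith)]
        refine annularGlue_of_notMem hj ?_ hx'
        rw [Nat.floor_eq_iff (by positivity)]
        exact ⟨by linarith [hτ (n + 1)], h⟩
  have hR : ∀ n : ℕ, ∀ x : E, n + 1 / 2 - τ n < ‖x‖ ^ 2 → ‖x‖ ^ 2 < n + 1 / 2 + τ (n + 1) →
      annularGlue τ V R x = R n x := by
    intro n x h3 h4
    have hn : ⌊‖x‖ ^ 2⌋₊ = n := by
      rw [Nat.floor_eq_iff (by positivity)]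
      constructor <;> linarith [hτ' n, hτ' (n + 1)]
    rcases lt_or_ge (‖x‖ ^ 2) (n + 1 / 2) with h | h
    · refine annularGlue_of_notMem (j := n) ?_ hn fun hx => ?_
      · rw [Nat.floor_eq_iff (by positivity)]
        constructor <;> linarith [hτ' n, hτ' (n + 1)]
      · linarith [(abs_lt.1 (show |‖x‖ ^ 2 - n| < _ from hx)).2]
    · refine annularGlue_of_notMem (j := n + 1) ?_ hn fun hx => ?_
      · rw [Nat.floor_eq_iff (by positivity)]
        push_cast
        constructor <;> linarith [hτ' n, hτ' (n + 1)]
      · have := (abs_lt.1 (show |‖x‖ ^ 2 - (n + 1 : ℕ)| < _ from hx)).1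
        push_cast at this
        linarith
  have hRev : ∀ n : ℕ, ∀ x : E, n + 1 / 2 - τ n < ‖x‖ ^ 2 → ‖x‖ ^ 2 < n + 1 / 2 + τ (n + 1) →
      annularGlue τ V R =ᶠ[𝓝 x] R n := by
    intro n x h3 h4
    have hc : Continuous fun x : E => ‖x‖ ^ 2 := by fun_prop
    filter_upwards [(isOpen_lt continuous_const hc).mem_nhds h3,
      (isOpen_lt hc continuous_const).mem_nhds h4] with z hz3 hz4 using hR n z hz3 hz4
  obtain ⟨h3, h4⟩ := (Nat.floor_eq_iff (by positivity : (0 : ℝ) ≤ ‖x‖ ^ 2 + 1 / 2)).1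
    (rfl : ⌊‖x‖ ^ 2 + 1 / 2⌋₊ = _)
  set j := ⌊‖x‖ ^ 2 + 1 / 2⌋₊
  by_cases hx : x ∈ shell E j (1 / 2 - τ j / 2)
  · refine ⟨j, by linarith, Or.inl ?_⟩
    filter_upwards [(isOpen_shell j _).mem_nhds hx] with z hz using hV j z hz
  · have hx' : 1 / 2 - τ j / 2 ≤ |‖x‖ ^ 2 - j| := not_lt.1 hx
    rcases le_abs.1 hx' with h | h
    · exact ⟨j, by linarith, Or.inr (hRev j x (by linarith [hτ j]) (by linarith [hτ (j + 1)]))⟩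
    · cases hj : j with
      | zero =>
        rw [hj, Nat.cast_zero] at h
        nlinarith [sq_nonneg ‖x‖, hτ' 0]
      | succ n =>
        rw [hj] at h h3 h4
        push_cast at h h3 h4
        exact ⟨n, by linarith [hτ' (n + 1)], Or.inr (hRev n x (by linarith [hτ n])
          (by linarith [hτ (n + 1)]))⟩

lemma compl_shell_subset (x : E) (hx : ∀ j : ℕ, x ∉ sphere (0 : E) (Real.sqrt (j + 1 / 2))) :
    ∃ j, x ∈ shell E j (1 / 2) := by
  obtain ⟨h3, h4⟩ := (Nat.floor_eq_iff (by positivity : (0 : ℝ) ≤ ‖x‖ ^ 2 + 1 / 2)).1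
    (rfl : ⌊‖x‖ ^ 2 + 1 / 2⌋₊ = _)
  set j := ⌊‖x‖ ^ 2 + 1 / 2⌋₊ with hj
  have hle : -(1 / 2 : ℝ) ≤ ‖x‖ ^ 2 - j := by linarith
  refine ⟨j, abs_lt.2 ⟨lt_of_le_of_ne hle fun h => ?_, by linarith⟩⟩
  cases hj' : j with
  | zero =>
    rw [hj', Nat.cast_zero] at h
    linarith [sq_nonneg ‖x‖]
  | succ n =>
    rw [hj'] at h
    push_cast at h
    refine hx n ?_
    rw [mem_sphere_zero_iff_norm, show (n : ℝ) + 1 / 2 = ‖x‖ ^ 2 by linarith,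
      Real.sqrt_sq (norm_nonneg x)]

/-- A smooth radial function which is `0` for `‖x‖ ^ 2 ≤ c - σ` and `1` for `c + σ ≤ ‖x‖ ^ 2`. -/
noncomputable def radialStep (c σ : ℝ) (x : E) : ℝ :=
  Real.smoothTransition ((‖x‖ ^ 2 - (c - σ)) / (2 * σ))

lemma radialStep_mem_Icc (c σ : ℝ) (x : E) : radialStep c σ x ∈ Icc (0 : ℝ) 1 :=
  ⟨Real.smoothTransition.nonneg _, Real.smoothTransition.le_one _⟩

lemma radialStep_eq_zero {c σ : ℝ} (hσ : 0 < σ) {x : E} (hx : ‖x‖ ^ 2 ≤ c - σ) :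
    radialStep c σ x = 0 :=
  Real.smoothTransition.zero_of_nonpos (div_nonpos_of_nonpos_of_nonneg (by linarith) (by linarith))

lemma radialStep_eq_one {c σ : ℝ} (hσ : 0 < σ) {x : E} (hx : c + σ ≤ ‖x‖ ^ 2) :
    radialStep c σ x = 1 :=
  Real.smoothTransition.one_of_one_le ((one_le_div (by positivity)).2 (by linarith))

variable [InnerProductSpace ℝ E]

lemma contDiff_radialStep (c σ : ℝ) : ContDiff ℝ 2 (radialStep c σ : E → ℝ) :=
  (Real.smoothTransition.contDiff (n := 2)).comp
    (((contDiff_norm_sq ℝ).sub contDiff_const).div_const _)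

variable [FiniteDimensional ℝ E] [MeasurableSpace E] [BorelSpace E]

lemma exists_shell_extension {u : E → ℝ} (hu : LocallyLipschitz u) {η η' : ℝ} (hη : 0 < η)
    (hη' : η' < η) (hconv : ConvexOn ℝ univ fun x => u x - η / 2 * ‖x‖ ^ 2) (j : ℕ) {ε : ℝ}
    (hε : 0 < ε) {ε' : ℝ≥0∞} (hε' : 0 < ε') :
    ∃ (K : Set E) (τ : ℝ), 0 < τ ∧ τ ≤ 1 / 4 ∧ K ⊆ shell E j (1 / 2 - τ) ∧
      volume (shell E j (1 / 2) \ K) < ε' ∧ ∀ δ > 0, ∃ ρ, 0 < ρ ∧ ρ < δ ∧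
      ∃ v : E → ℝ, ContDiff ℝ 2 v ∧ (∀ k ∈ K, v k = u k) ∧
        (∀ x ∉ shell E j (1 / 2 - τ), v x = mollify ρ u x) ∧
        ∀ x, v =ᶠ[𝓝 x] mollify ρ u ∨ (∀ e, η' * ‖e‖ ^ 2 ≤ hessianForm v x e) ∧
          |v x - u x| ≤ ε := by
  have hm : MeasurableSet (shell E j (1 / 2)) := (isOpen_shell j _).measurableSet
  have hfin : volume (shell E j (1 / 2)) ≠ ∞ := by
    refine ne_top_of_le_ne_top (measure_ball_lt_top (x := (0 : E)) (r := j + 1)).ne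
      (measure_mono fun x hx => ?_)
    have := (abs_lt.1 (show |‖x‖ ^ 2 - j| < _ from hx)).2
    rw [mem_ball_zero_iff]
    have hj : (0 : ℝ) ≤ j := Nat.cast_nonneg j
    nlinarith [norm_nonneg x]
  have hε2 : ε' / 2 ≠ 0 := (ENNReal.half_pos hε'.ne').ne'
  obtain ⟨K₀, M, p, A, hK₀, hM, hA, hT⟩ := exists_uniform_taylor hu.continuous
    (ae_exists_taylorRemainder_le hη hconv hu) hm hfin hε2
  obtain ⟨K₁, hK₁s, hK₁c, hK₁⟩ := hm.exists_isCompact_sdiff_lt (μ := volume) hfin hε2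
  obtain ⟨τ, hτ0, hτ1, hτ⟩ : ∃ τ : ℝ, 0 < τ ∧ τ ≤ 1 / 4 ∧ K₁ ⊆ shell E j (1 / 2 - τ) := by
    rcases K₁.eq_empty_or_nonempty with h | h
    · exact ⟨1 / 4, by norm_num, le_rfl, by simp [h]⟩
    obtain ⟨x, hx, hmax⟩ := hK₁c.exists_isMaxOn h
      (f := fun x : E => |‖x‖ ^ 2 - j|) (by fun_prop)
    have h1 : |‖x‖ ^ 2 - j| < 1 / 2 := hK₁s hx
    refine ⟨min (1 / 4) ((1 / 2 - |‖x‖ ^ 2 - j|) / 2), lt_min (by norm_num) (by linarith),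
      min_le_left _ _, fun z hz => ?_⟩
    have h2 : |‖z‖ ^ 2 - j| ≤ |‖x‖ ^ 2 - j| := hmax hz
    have h3 := min_le_right (1 / 4 : ℝ) ((1 / 2 - |‖x‖ ^ 2 - j|) / 2)
    show |‖z‖ ^ 2 - j| < _
    linarith
  obtain ⟨d₀, hd₀, hd₀s⟩ := hK₁c.exists_thickening_subset_open (isOpen_shell j _) hτ
  refine ⟨K₀ ∩ K₁, τ, hτ0, hτ1, inter_subset_right.trans hτ, ?_, fun δ hδ => ?_⟩
  · rw [sdiff_inter]
    exact (measure_union_le _ _).trans_lt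
      ((ENNReal.add_lt_add hK₀ hK₁).trans_eq (ENNReal.add_halves _))
  obtain ⟨ρ, d, hρ0, hρ, hd0, hd, v, hv, hvK, hv1, hv2⟩ := exists_local_extension hu.continuous
    hη' hconv hM (K := K₀ ∩ K₁) (fun k hk => hA k hk.1)
    (fun ω hω => (hT ω hω).imp fun δ h => ⟨h.1, fun k hk => h.2 k hk.1⟩)
    (δ := min δ d₀) (lt_min hδ hd₀) hε
  refine ⟨ρ, hρ0, hρ.trans_le (min_le_left _ _), v, hv, hvK, fun x hx => ?_, fun x => ?_⟩
  · refine (hv1 x fun hx' => hx (hd₀s ?_)).self_of_nhds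
    exact thickening_mono (hd.le.trans (min_le_right _ _)) _
      (thickening_subset_of_subset _ inter_subset_right hx')
  · by_cases hx : x ∈ thickening d (K₀ ∩ K₁)
    · exact Or.inr (hv2 x hx)
    · exact Or.inl (hv1 x hx)

/-- Lusin approximation of a strongly convex function by `C²` functions with a lower bound on the
Hessian, uniformly close to it. -/
theorem exists_contDiff_lusin {u : E → ℝ} (hu : LocallyLipschitz u) {η η' : ℝ} (hη : 0 < η)
    (hη' : η' < η) (hconv : ConvexOn ℝ univ fun x => u x - η / 2 * ‖x‖ ^ 2) {ε : ℝ}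
    (hε : 0 < ε) {ε' : ℝ≥0∞} (hε' : ε' ≠ 0) :
    ∃ v : E → ℝ, ContDiff ℝ 2 v ∧ (∀ x e, η' * ‖e‖ ^ 2 ≤ hessianForm v x e) ∧
      (∀ x, |v x - u x| ≤ ε) ∧ volume {x | v x ≠ u x} < ε' := by
  obtain ⟨w, hw0, hw⟩ := ENNReal.exists_pos_sum_of_countable' hε' ℕ
  choose K τ hτ0 hτ1 hKτ hK hext using fun j : ℕ =>
    exists_shell_extension hu hη hη' hconv j hε (hw0 j)
  set σ : ℕ → ℝ := fun j => min (τ j) (τ (j + 1)) / 2 with hσ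
  have hσ0 : ∀ j, 0 < σ j := fun j => half_pos (lt_min (hτ0 j) (hτ0 (j + 1)))
  have hσ1 : ∀ j, σ j ≤ τ j / 2 := fun j => by
    simp only [hσ]
    linarith [min_le_left (τ j) (τ (j + 1))]
  have hσ2 : ∀ j, σ j ≤ τ (j + 1) / 2 := fun j => by
    simp only [hσ]
    linarith [min_le_right (τ j) (τ (j + 1))]
  set θ : ℕ → E → ℝ := fun j => radialStep (j + 1 / 2) (σ j) with hθ
  choose r hr0 hr using fun j : ℕ => exists_forall_mollify_variable hu hη.le hη' hconv
    (contDiff_radialStep (j + 1 / 2) (σ j)) (radialStep_mem_Icc (j + 1 / 2) (σ j)) (j + 2) hε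
  choose ρ hρ0 hρ V hV hVK hV0 hVx using fun j =>
    hext j (min (r j) (r (j - 1))) (lt_min (hr0 _) (hr0 _))
  have hρr : ∀ j, ρ j < r j := fun j => (hρ j).trans_le (min_le_left _ _)
  have hρr' : ∀ j, ρ (j + 1) < r j := fun j => (hρ (j + 1)).trans_le (min_le_right _ _)
  set R : ℕ → E → ℝ := fun j x => mollify (ρ j + (ρ (j + 1) - ρ j) * θ j x) u x with hR
  have hball : ∀ {x : E} {j : ℕ}, ‖x‖ ^ 2 < j + 1 → x ∈ ball (0 : E) (j + 2) := by
    intro x j h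
    rw [mem_ball_zero_iff]
    have hj : (0 : ℝ) ≤ j := Nat.cast_nonneg j
    nlinarith [norm_nonneg x]
  have hRp := fun j => hr j (ρ j) (ρ (j + 1)) (hρ0 j) (hρr j) (hρ0 _) (hρr' j)
  have hVp : ∀ j : ℕ, ∀ x ∈ ball (0 : E) (j + 2),
      (∀ e, η' * ‖e‖ ^ 2 ≤ hessianForm (V j) x e) ∧ |V j x - u x| ≤ ε := by
    intro j x hx
    rcases hVx j x with h | h
    · have := (hr j (ρ j) (ρ j) (hρ0 j) (hρr j) (hρ0 j) (hρr j)).2 x hx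
      simp only [sub_self, zero_mul, add_zero] at this
      refine ⟨fun e => ?_, ?_⟩
      · rw [hessianForm_congr h]
        exact this.1 e
      · rw [h.self_of_nhds]
        exact this.2
    · exact h
  have hglue := annularGlue_eventuallyEq (V := V) (R := R) hτ0 hτ1
    (fun j x hx _ h => by
      have : θ j x = 0 := radialStep_eq_zero (hσ0 j) (by linarith [hσ1 j])
      simp only [hV0 j x hx, hR, this, mul_zero, add_zero])
    (fun j x hx _ h => by
      have : θ j x = 1 := radialStep_eq_one (hσ0 j) (by linarith [hσ2 j])
      simp only [hV0 (j + 1) x hx, hR, this, mul_one, add_sub_cancel])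
  refine ⟨annularGlue τ V R, contDiff_iff_contDiffAt.2 fun x => ?_, fun x e => ?_, fun x => ?_, ?_⟩
  · obtain ⟨j, hj, h | h⟩ := hglue x
    · exact (hV j).contDiffAt.congr_of_eventuallyEq h
    · exact (hRp j).1.contDiffAt.congr_of_eventuallyEq h
  · obtain ⟨j, hj, h | h⟩ := hglue x
    · rw [hessianForm_congr h]
      exact (hVp j x (hball hj)).1 e
    · rw [hessianForm_congr h]
      exact ((hRp j).2 x (hball hj)).1 e
  · obtain ⟨j, hj, h | h⟩ := hglue x
    · rw [h.self_of_nhds]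
      exact (hVp j x (hball hj)).2
    · rw [h.self_of_nhds]
      exact ((hRp j).2 x (hball hj)).2
  · have hsub : {x | annularGlue τ V R x ≠ u x} ⊆ (⋃ j, shell E j (1 / 2) \ K j) ∪
        ⋃ j : ℕ, sphere (0 : E) (Real.sqrt (j + 1 / 2)) := by
      intro x hx
      by_contra hx'
      simp only [mem_union, mem_iUnion, not_or, not_exists] at hx'
      obtain ⟨j, hj⟩ := compl_shell_subset x hx'.2
      have hxK : x ∈ K j := by
        by_contra hxK
        exact hx'.1 j ⟨hj, hxK⟩
      exact hx ((annularGlue_of_mem hτ0 (hKτ j hxK)).trans (hVK j x hxK))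
    have hnull : volume (⋃ j : ℕ, sphere (0 : E) (Real.sqrt (j + 1 / 2))) = 0 :=
      measure_iUnion_null fun j => Measure.addHaar_sphere_of_ne_zero _ _
        (Real.sqrt_pos.2 (by positivity)).ne'
    calc volume {x | annularGlue τ V R x ≠ u x}
        ≤ volume (⋃ j, shell E j (1 / 2) \ K j) + 0 :=
          (measure_mono hsub).trans ((measure_union_le _ _).trans_eq (by rw [hnull]))
      _ ≤ ∑' j, volume (shell E j (1 / 2) \ K j) := by
          rw [add_zero]
          exact measure_iUnion_le _
      _ ≤ ∑' j, w j := ENNReal.tsum_le_tsum fun j => (hK j).le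
      _ < ε' := hw

end AnnularGlue

section Final

open scoped RealInnerProductSpace Topology

lemma convexOn_of_le_hessianForm {E : Type*} [NormedAddCommGroup E] [InnerProductSpace ℝ E]
    {v : E → ℝ} (hv : ContDiff ℝ 2 v) {η : ℝ} (h : ∀ x e, η * ‖e‖ ^ 2 ≤ hessianForm v x e) :
    ConvexOn ℝ univ fun x => v x - η / 2 * ‖x‖ ^ 2 := by
  set q : E → ℝ := quadratic 0 0 0 (η • ContinuousLinearMap.id ℝ E) with hq
  have hqC : ContDiff ℝ 2 q := contDiff_quadratic _ _ _ _
  have hqe : (fun x => v x - η / 2 * ‖x‖ ^ 2) = v - q := by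
    funext z
    simp [hq, quadratic, inner_smul_left]
    ring
  have hw : ContDiff ℝ (2 : ℕ) (v - q) := hv.sub hqC
  rw [hqe]
  refine ⟨convex_univ, fun x _ y _ a b ha hb hab => ?_⟩
  have hφ : ContDiff ℝ 2 fun t : ℝ => (v - q) (x + t • (y - x)) :=
    hw.comp (contDiff_const.add (contDiff_id.smul contDiff_const))
  have hφ1 : Differentiable ℝ (deriv fun t : ℝ => (v - q) (x + t • (y - x))) :=
    ((contDiff_succ_iff_deriv (n := 1)).1 hφ).2.2.differentiable one_ne_zero
  have hconv := convexOn_univ_of_deriv2_nonneg (hφ.differentiable two_ne_zero) hφ1 fun t => by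
    rw [← iteratedDeriv_eq_iterate, iteratedDeriv_line hw]
    have h1 := hessianForm_sub hv hqC (x + t • (y - x)) (y - x)
    rw [hq, hessianForm_quadratic] at h1
    have h2 := h (x + t • (y - x)) (y - x)
    change 0 ≤ hessianForm (v - q) _ _
    rw [hq, h1]
    simp only [_root_.smul_apply, ContinuousLinearMap.id_apply, inner_smul_left,
      real_inner_self_eq_norm_sq, RCLike.conj_to_real]
    linarith
  have h3 := hconv.2 (mem_univ 0) (mem_univ 1) ha hb hab
  have e1 : x + (a • (0 : ℝ) + b • (1 : ℝ)) • (y - x) = a • x + b • y := by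
    rw [smul_zero, zero_add, smul_eq_mul, mul_one, eq_sub_of_add_eq hab]
    module
  simpa only [e1, zero_smul, add_zero, one_smul, add_sub_cancel] using h3

lemma locallyLipschitz_of_convexOn_sub_sq {E : Type*} [NormedAddCommGroup E]
    [InnerProductSpace ℝ E] [FiniteDimensional ℝ E] {u : E → ℝ} {η : ℝ}
    (hconv : ConvexOn ℝ univ fun x => u x - η / 2 * ‖x‖ ^ 2) : LocallyLipschitz u := by
  have h1 : ContDiff ℝ 1 fun x : E => η / 2 * ‖x‖ ^ 2 := contDiff_const.mul (contDiff_norm_sq ℝ)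
  have h2 := hconv.locallyLipschitz.add h1.locallyLipschitz
  simpa only [sub_add_cancel] using h2

end Final

/-- A sequence of `C²` strongly convex Lusin approximations converging
uniformly on compact sets. -/
theorem strongly_convex_C2_lusin_approx_seq {n : ℕ}
    (u : EuclideanSpace ℝ (Fin n) → ℝ) (η : ℝ) (hη : 0 < η)
    (hu : StronglyConvexWith η u)
    (η' : ℝ) (hη' : 0 < η') (hη'η : η' < η)
    (ε : ℕ → ℝ) (hε : ∀ k, 0 < ε k) (hεlim : Tendsto ε atTop (nhds 0)) :
    ∃ v : ℕ → EuclideanSpace ℝ (Fin n) → ℝ,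
      (∀ k, ContDiff ℝ 2 (v k) ∧ StronglyConvexWith η' (v k) ∧
        volume {x | v k x ≠ u x} < ENNReal.ofReal (ε k)) ∧
      (∀ K : Set (EuclideanSpace ℝ (Fin n)), IsCompact K →
        TendstoUniformlyOn v u atTop K) := by
  choose v hv hvH hvu hvm using fun k =>
    exists_contDiff_lusin (locallyLipschitz_of_convexOn_sub_sq hu) hη hη'η hu (hε k)
      (ENNReal.ofReal_pos.2 (hε k)).ne'
  refine ⟨v, fun k => ⟨hv k, convexOn_of_le_hessianForm (hv k) (hvH k), hvm k⟩, fun K _ => ?_⟩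
  rw [Metric.tendstoUniformlyOn_iff]
  intro b hb
  filter_upwards [hεlim.eventually (gt_mem_nhds hb)] with k hk x _
  rw [dist_comm, Real.dist_eq]
  exact (hvu k x).trans_lt hk
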